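/- There is no pair (x, y) ∈ ℚ × ℚ satisfying y² = x⁶ − 2x⁵ + 5x⁴ − 6x³ + 10x² − 8x + 5; the equation has no rational solutions. -/

import Mathlib

namespace C9
open Polynomial

/-- The sextic. -/
noncomputable def fZ : ℤ[X] := X^6 - 2*X^5 + 5*X^4 - 6*X^3 + 10*X^2 - 8*X + 5

lemma fZ_natDegree : fZ.natDegree = 6 := by
  unfold fZ; compute_degree!

lemma fZ_monic : fZ.Monic := by
  unfold fZ; monicity!

lemma cubicF2_irred : Irreducible (X^3 + X^2 + 1 : (ZMod 2)[X]) := by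
  have hd : (X^3 + X^2 + 1 : (ZMod 2)[X]).natDegree = 3 := by compute_degree!
  rw [Polynomial.irreducible_iff_roots_eq_zero_of_degree_le_three (by omega) (by omega)]
  rw [Multiset.eq_zero_iff_forall_notMem]
  intro a ha
  have h := (Polynomial.mem_roots'.1 ha).2
  simp only [IsRoot, eval_add, eval_pow, eval_X, eval_one] at h
  revert h; revert a;
  have : ∀ a : ZMod 2, ¬ a^3 + a^2 + 1 = 0 := by decide
  intro a _ h; exact this a h

lemma fZ_map2 : fZ.map (Int.castRingHom (ZMod 2)) = (X^3 + X^2 + 1)^2 := by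
  unfold fZ
  simp only [Polynomial.map_add, Polynomial.map_sub, Polynomial.map_mul, Polynomial.map_pow, map_X, Polynomial.map_ofNat]
  have h2 : (2 : (ZMod 2)[X]) = 0 := by
    have : (2 : ZMod 2) = 0 := by decide
    have h := congrArg (C : ZMod 2 → (ZMod 2)[X]) this
    rwa [map_ofNat, map_zero] at h
  linear_combination (-2*X^5+2*X^4-4*X^3+4*X^2-4*X+2) * h2

lemma real_cubic_root (p : ℝ[X]) (hp : p.natDegree = 3) (hm : p.Monic) : ∃ x, p.IsRoot x := by
  have h1 : Filter.Tendsto (fun x => eval x p) Filter.atTop Filter.atTop :=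
    p.tendsto_atTop_of_leadingCoeff_nonneg (natDegree_pos_iff_degree_pos.1 (by omega)) (by rw [hm.leadingCoeff]; norm_num)
  have h2 : Filter.Tendsto (fun x => eval x (-(p.comp (-X)))) Filter.atTop Filter.atTop := by
    have hl : (-(p.comp (-X))).leadingCoeff = 1 := by
      rw [leadingCoeff_neg, leadingCoeff_comp (by simp), hm.leadingCoeff, hp]
      simp only [leadingCoeff_neg, leadingCoeff_X]; norm_num
    have hd : (-(p.comp (-X))).natDegree = 3 := by
      rw [natDegree_neg, natDegree_comp, hp]; simp
    exact tendsto_atTop_of_leadingCoeff_nonneg _ (natDegree_pos_iff_degree_pos.1 (by omega)) (by rw [hl]; norm_num)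
  obtain ⟨x, hx⟩ := (h1.eventually_ge_atTop 0).exists
  obtain ⟨y, hy⟩ := (h2.eventually_ge_atTop 0).exists
  simp only [eval_neg, eval_comp, eval_X] at hy
  have := mem_range_of_exists_le_of_exists_ge (c := (0:ℝ)) p.continuous ⟨-y, by linarith⟩ ⟨x, hx⟩
  obtain ⟨z, hz⟩ := this
  exact ⟨z, hz⟩

lemma fZ_irred : Irreducible fZ := by
  rw [fZ_monic.irreducible_iff_natDegree']
  refine ⟨?_, ?_⟩
  · intro h
    have := fZ_natDegree
    rw [h] at this; simp at this
  · intro p q hp hq hpq hmem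
    rw [fZ_natDegree] at hmem
    have hdeg : p.natDegree + q.natDegree = 6 := by
      rw [← hp.natDegree_mul hq, hpq, fZ_natDegree]
    have h2 : q.map (Int.castRingHom (ZMod 2)) ∣ (X^3 + X^2 + 1 : (ZMod 2)[X])^2 := by
      rw [← fZ_map2, ← hpq, Polynomial.map_mul]; exact dvd_mul_left _ _
    rw [dvd_prime_pow cubicF2_irred.prime] at h2
    obtain ⟨i, hi, ha⟩ := h2
    have hd := Polynomial.natDegree_eq_of_degree_eq (Polynomial.degree_eq_degree_of_associated ha)
    rw [hq.natDegree_map, natDegree_pow] at hd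
    have hd3 : (X^3 + X^2 + 1 : (ZMod 2)[X]).natDegree = 3 := by compute_degree!
    rw [hd3] at hd
    have hq3 : q.natDegree = 3 := by
      simp at hmem
      omega
    obtain ⟨x, hx⟩ := real_cubic_root (q.map (Int.castRingHom ℝ)) (by rw [hq.natDegree_map, hq3]) (hq.map _)
    have : (fZ.map (Int.castRingHom ℝ)).eval x = 0 := by
      rw [← hpq, Polynomial.map_mul, eval_mul, hx, mul_zero]
    unfold fZ at this
    simp at this
    nlinarith [sq_nonneg (x^3-x^2+1), sq_nonneg (2*(x^2-x+1)), sq_nonneg (x-1/2), sq_nonneg (x^2-x)]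

/-- the field -/
noncomputable abbrev fQ : ℚ[X] := fZ.map (Int.castRingHom ℚ)

lemma fQ_irred : Irreducible fQ := by
  have := (Polynomial.Monic.irreducible_iff_irreducible_map_fraction_map (K := ℚ) fZ_monic).1 fZ_irred
  simpa using this

structure FD (K : Type) [Field K] [NumberField K] where
  τ : NumberField.RingOfIntegers K
  I : NumberField.RingOfIntegers K
  hI : I^2 = -1
  hτ : τ^3 = (1 - 2*I)*τ^2 + 2*I*τ + (-1-2*I)
  b : Module.Basis (Fin 6) ℚ K
  hb : ∀ i, b i = ![1, (τ:K), (τ:K)^2, (I:K), (I:K)*τ, (I:K)*(τ:K)^2] i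
  hf : ∀ p : ℤ[X], aeval τ p = 0 → fZ ∣ p

theorem mk_FD (K : Type) [Field K] [NumberField K] (t : K) (hfr : Module.finrank ℚ K = 6)
   (hz : ∀ p : ℚ[X], aeval t p = 0 → fQ ∣ p)
   (ht : t^6 - 2*t^5 + 5*t^4 - 6*t^3 + 10*t^2 - 8*t + 5 = 0) : Nonempty (FD K) := by
  have hdeg : fQ.natDegree = 6 := by rw [fZ_monic.natDegree_map, fZ_natDegree]
  have hB : t^2 - t + 1 ≠ 0 := by
    intro h
    have hA : (t^3 - t^2 + 1)^2 = 0 := by linear_combination ht - 4*(t^2-t+1)*h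
    have hA' := pow_eq_zero_iff (two_ne_zero) |>.1 hA
    have : (1:K) = 0 := by linear_combination (1-t^2)*h + t*hA'
    exact one_ne_zero this
  obtain ⟨i, hi⟩ : ∃ i : K, i = -(t^3-t^2+1)/(2*(t^2-t+1)) := ⟨_, rfl⟩
  have hiB : 2*(t^2-t+1)*i = -(t^3-t^2+1) := by
    rw [hi, mul_div_cancel₀ _ (mul_ne_zero two_ne_zero hB)]
  have hi2 : i^2 = -1 := by
    have : 4*(t^2-t+1)^2*(i^2+1) = 0 := by
      linear_combination ht + (2*(t^2-t+1)*i - (t^3-t^2+1))*hiB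
    have h4 : 4*(t^2-t+1)^2 ≠ 0 := mul_ne_zero (by norm_num) (pow_ne_zero _ hB)
    have := (mul_eq_zero.1 this).resolve_left h4
    linear_combination this
  have htI : IsIntegral ℤ t := by
    refine ⟨fZ, fZ_monic, ?_⟩
    rw [← aeval_def]; unfold fZ
    simpa only [map_add, map_sub, map_mul, map_pow, aeval_X, map_ofNat] using ht
  have hiI : IsIntegral ℤ i := by
    refine ⟨X^2+1, by monicity!, ?_⟩
    simp [hi2]
  have hcub : t^3 = (1 - 2*i)*t^2 + 2*i*t + (-1-2*i) := by
    linear_combination hiB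
  have hli : LinearIndependent ℚ ![1, t, t^2, i, i*t, i*t^2] := by
    rw [Fintype.linearIndependent_iff]
    intro g hg
    simp only [Fin.sum_univ_six, Algebra.smul_def] at hg
    simp at hg
    set P : ℚ[X] := 2*(X^2-X+1)*(C (g 0) + C (g 1)*X + C (g 2)*X^2) - (X^3-X^2+1)*(C (g 3) + C (g 4)*X + C (g 5)*X^2) with hP
    have hPt : aeval t P = 0 := by
      simp only [hP, map_sub, map_mul, map_add, map_pow, aeval_X, aeval_C, map_one, map_ofNat]
      simp only [eq_ratCast] at hg ⊢
      linear_combination 2*(t^2-t+1)*hg - (g 3+g 4*t+g 5*t^2)*hiB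
    have hP0 : P = 0 := by
      by_contra hne
      have h1 := Polynomial.natDegree_le_of_dvd (hz P hPt) hne
      have h2 : P.natDegree ≤ 5 := by rw [hP]; compute_degree
      omega
    have hP' : P = C (2 * g 0 - g 3) + C (2*g 1 - 2*g 0 - g 4) * X + C (2*g 2 - 2* g 1 + 2* g 0 + g 3 - g 5)*X^2 + C (2 * g 1 - 2 * g 2 - g 3 + g 4)*X^3 + C (2 * g 2 - g 4 + g 5)*X^4 + C (- g 5)*X^5 := by
      rw [hP]; simp only [map_sub, map_add, map_mul, map_neg, map_ofNat]; ring
    have hc : ∀ n, P.coeff n = 0 := by intro n; rw [hP0]; simp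
    rw [hP'] at hc
    have c0 := hc 0
    have c1 := hc 1
    have c2 := hc 2
    have c3 := hc 3
    have c4 := hc 4
    have c5 := hc 5
    simp only [coeff_add, coeff_C_mul, coeff_X, coeff_C, coeff_X_pow] at c0 c1 c2 c3 c4 c5
    norm_num at c0 c1 c2 c3 c4 c5
    intro j
    fin_cases j <;> simp <;> linarith
  obtain ⟨τ, rfl⟩ : ∃ τ : NumberField.RingOfIntegers K, (τ:K) = t := ⟨⟨t,htI⟩, rfl⟩
  obtain ⟨I, rfl⟩ : ∃ τ : NumberField.RingOfIntegers K, (τ:K) = i := ⟨⟨i,hiI⟩, rfl⟩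
  refine ⟨⟨τ, I, ?_, ?_, basisOfLinearIndependentOfCardEqFinrank hli (by rw [hfr]; rfl), ?_, ?_⟩⟩
  · apply NumberField.RingOfIntegers.ext; simpa using hi2
  · apply NumberField.RingOfIntegers.ext
    simp only [map_add, map_mul, map_sub, map_pow, map_one, map_neg, map_ofNat]; exact hcub
  · intro j; simp
  · intro p hp
    have h1 : aeval (τ:K) p = 0 := by
      have := congrArg (algebraMap (NumberField.RingOfIntegers K) K) hp
      rw [← aeval_algebraMap_apply, map_zero] at this
      exact this
    have h2 := hz (p.map (Int.castRingHom ℚ)) ((Polynomial.aeval_map_algebraMap ℚ (τ:K) p).trans h1)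
    exact (Polynomial.map_dvd_map (Int.castRingHom ℚ) (Int.cast_injective) fZ_monic).1 h2

theorem exists_FD : ∃ (K : Type) (_ : Field K) (_ : NumberField K), Nonempty (FD K) := by
  have : Fact (Irreducible fQ) := ⟨fQ_irred⟩
  have hdeg : fQ.natDegree = 6 := by rw [fZ_monic.natDegree_map, fZ_natDegree]
  have : FiniteDimensional ℚ (AdjoinRoot fQ) := (AdjoinRoot.powerBasis fQ_irred.ne_zero).finite
  have : NumberField (AdjoinRoot fQ) := ⟨⟩
  have hfr : Module.finrank ℚ (AdjoinRoot fQ) = 6 := by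
    rw [(AdjoinRoot.powerBasis fQ_irred.ne_zero).finrank, AdjoinRoot.powerBasis_dim, hdeg]
  have key : ∀ p : ℚ[X], aeval (AdjoinRoot.root fQ) p = AdjoinRoot.mk fQ p := by
    intro p
    rw [aeval_def, Subsingleton.elim (algebraMap ℚ (AdjoinRoot fQ)) (AdjoinRoot.of fQ), ← AdjoinRoot.aeval_eq]
    rfl
  refine ⟨AdjoinRoot fQ, inferInstance, inferInstance, mk_FD _ (AdjoinRoot.root fQ) hfr ?_ ?_⟩
  · intro p hp
    rwa [key, AdjoinRoot.mk_eq_zero] at hp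
  · have h := key fQ
    rw [AdjoinRoot.mk_self] at h
    have e : fQ = X^6 - 2*X^5 + 5*X^4 - 6*X^3 + 10*X^2 - 8*X + 5 := by
      unfold fQ fZ
      simp only [Polynomial.map_add, Polynomial.map_sub, Polynomial.map_mul, Polynomial.map_pow, map_X, Polynomial.map_ofNat]
    generalize AdjoinRoot.root fQ = t at h ⊢
    have h' := (congrArg (aeval t) e).symm.trans h
    rw [← h']
    simp only [map_add, map_sub, map_mul, map_pow, aeval_X, map_ofNat]
end C9

namespace C9
open Polynomial NumberField

/-- coordinates -/
@[ext] structure V6 where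
  a0 : ℤ
  a1 : ℤ
  a2 : ℤ
  b0 : ℤ
  b1 : ℤ
  b2 : ℤ
deriving DecidableEq

namespace V6
def red (x : V6) (u v : ℤ) : V6 :=
  ⟨x.a0 + (-u + 2*v), x.a1 - 2*v, x.a2 + (u + 2*v), x.b0 + (-v - 2*u), x.b1 + 2*u, x.b2 + (v - 2*u)⟩

def shred (x : V6) (u v : ℤ) : V6 × ℤ × ℤ :=
  (⟨x.a0, x.a1 + (-u + 2*v), x.a2 - 2*v, x.b0, x.b1 + (-v - 2*u), x.b2 + 2*u⟩, u + 2*v, v - 2*u)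

def cm (x y : V6) : V6 :=
  let r4 := x.a2*y.a2 - x.b2*y.b2
  let i4 := x.a2*y.b2 + x.b2*y.a2
  let r3 := x.a1*y.a2 - x.b1*y.b2 + (x.a2*y.a1 - x.b2*y.b1) + (r4 + 2*i4)
  let i3 := x.a1*y.b2 + x.b1*y.a2 + (x.a2*y.b1 + x.b2*y.a1) + (i4 - 2*r4)
  ⟨x.a0*y.a0 - x.b0*y.b0 + (-r3 + 2*i3),
   x.a0*y.a1 - x.b0*y.b1 + (x.a1*y.a0 - x.b1*y.b0) + (-r4 + 2*i4) - 2*i3,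
   x.a0*y.a2 - x.b0*y.b2 + (x.a1*y.a1 - x.b1*y.b1) + (x.a2*y.a0 - x.b2*y.b0) - 2*i4 + (r3 + 2*i3),
   x.a0*y.b0 + x.b0*y.a0 + (-i3 - 2*r3),
   x.a0*y.b1 + x.b0*y.a1 + (x.a1*y.b0 + x.b1*y.a0) + (-i4 - 2*r4) + 2*r3,
   x.a0*y.b2 + x.b0*y.a2 + (x.a1*y.b1 + x.b1*y.a1) + (x.a2*y.b0 + x.b2*y.a0) + 2*r4 + (i3 - 2*r3)⟩

def add (x y : V6) : V6 := ⟨x.a0+y.a0, x.a1+y.a1, x.a2+y.a2, x.b0+y.b0, x.b1+y.b1, x.b2+y.b2⟩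
def sm (n : ℤ) (y : V6) : V6 := ⟨n*y.a0, n*y.a1, n*y.a2, n*y.b0, n*y.b1, n*y.b2⟩
def md (n : ℤ) (y : V6) : V6 := ⟨y.a0 % n, y.a1 % n, y.a2 % n, y.b0 % n, y.b1 % n, y.b2 % n⟩
def dv (n : ℤ) (y : V6) : V6 := ⟨y.a0 / n, y.a1 / n, y.a2 / n, y.b0 / n, y.b1 / n, y.b2 / n⟩

lemma md_dv (n : ℤ) (y : V6) : y = add (md n y) (sm n (dv n y)) := by
  ext <;> simp [add, sm, md, dv, Int.emod_add_mul_ediv]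

end V6
open V6

variable {K : Type} [Field K] [NumberField K]

def FD.E (D : FD K) (x : V6) : 𝓞 K :=
  x.a0 + x.a1*D.τ + x.a2*D.τ^2 + D.I*(x.b0 + x.b1*D.τ + x.b2*D.τ^2)

lemma FD.red3 (D : FD K) (u v : 𝓞 K) : (u + D.I*v)*D.τ^3 = (-u+2*v + D.I*(-v-2*u)) + (-2*v+D.I*(2*u))*D.τ
    + (u + 2*v + D.I*(v-2*u))*D.τ^2 := by
  linear_combination (u + D.I*v)*D.hτ + (-2*v*D.τ^2 + 2*v*D.τ - 2*v)*D.hI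

lemma FD.E_add (D : FD K) (x y : V6) : D.E (add x y) = D.E x + D.E y := by
  simp only [FD.E, add]; push_cast; ring

lemma FD.E_sm (D : FD K) (n : ℤ) (y : V6) : D.E (sm n y) = n * D.E y := by
  simp only [FD.E, sm]; push_cast; ring

lemma FD.E_mul (D : FD K) (x y : V6) : D.E (cm x y) = D.E x * D.E y := by
  have h4 := D.red3 (x.a2*y.a2 - x.b2*y.b2) (x.a2*y.b2 + x.b2*y.a2)
  have h3 := D.red3 (x.a1*y.a2 - x.b1*y.b2 + (x.a2*y.a1 - x.b2*y.b1) + ((x.a2*y.a2 - x.b2*y.b2) + 2*(x.a2*y.b2 + x.b2*y.a2)))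
     (x.a1*y.b2 + x.b1*y.a2 + (x.a2*y.b1 + x.b2*y.a1) + ((x.a2*y.b2 + x.b2*y.a2) - 2*(x.a2*y.a2 - x.b2*y.b2)))
  simp only [FD.E, cm]; push_cast
  linear_combination (-1)*D.τ*h4 - h3 - (x.b0*y.b0 + (x.b0*y.b1+x.b1*y.b0)*D.τ + (x.b0*y.b2+x.b1*y.b1+x.b2*y.b0)*D.τ^2 + (x.b1*y.b2+x.b2*y.b1)*D.τ^3 + x.b2*y.b2*D.τ^4)*D.hI

lemma FD.E_inj (D : FD K) {x y : V6} (h : D.E x = D.E y) : x = y := by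
  have hli := D.b.linearIndependent
  rw [Fintype.linearIndependent_iff] at hli
  have := hli (fun i => ((![x.a0-y.a0, x.a1-y.a1, x.a2-y.a2, x.b0-y.b0, x.b1-y.b1, x.b2-y.b2] i : ℤ) : ℚ)) (by
    simp only [Fin.sum_univ_six, D.hb, Algebra.smul_def]
    have h' := congrArg (algebraMap (𝓞 K) K) h
    simp only [FD.E] at h'
    simp only [map_add, map_mul, map_pow, map_intCast] at h'
    simp
    linear_combination h')
  have t0 := this 0
  have t1 := this 1
  have t2 := this 2
  have t3 := this 3
  have t4 := this 4
  have t5 := this 5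
  simp only [Int.cast_eq_zero] at t0 t1 t2 t3 t4 t5
  simp at t0 t1 t2 t3 t4 t5
  ext <;> omega

lemma FD.E_span (D : FD K) (s : 𝓞 K) : ∃ (N : ℤ) (x : V6), N ≠ 0 ∧ N * s = D.E x := by
  obtain ⟨N, hN⟩ := IsLocalization.exist_integer_multiples_of_finset (nonZeroDivisors ℤ) (Finset.univ.image (fun i => D.b.repr (s:K) i))
  have hN' : ∀ i, ∃ z : ℤ, (z:ℚ) = (N:ℤ) * D.b.repr (s:K) i := by
    intro i
    obtain ⟨z, hz⟩ := hN _ (Finset.mem_image_of_mem _ (Finset.mem_univ i))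
    exact ⟨z, by simpa using hz⟩
  choose z hz using hN'
  refine ⟨N, ⟨z 0, z 1, z 2, z 3, z 4, z 5⟩, nonZeroDivisors.coe_ne_zero N, ?_⟩
  apply RingOfIntegers.ext
  simp only [FD.E, map_add, map_mul, map_pow, map_intCast]
  have hz' : ∀ i, (z i : K) = (N:ℤ) * ((D.b.repr (s:K) i : ℚ) : K) := by
    intro i
    have := congrArg (Rat.cast : ℚ → K) (hz i)
    push_cast at this
    exact this
  have hs := D.b.sum_repr (s:K)
  simp only [Fin.sum_univ_six, D.hb, Algebra.smul_def] at hs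
  simp at hs
  simp only [hz']
  linear_combination (-(N:ℤ):K)*hs

lemma FD.int_dvd (D : FD K) {m n : ℤ} (h : (m : 𝓞 K) ∣ n) : m ∣ n := by
  obtain ⟨y, hy⟩ := h
  by_cases hm : m = 0
  · subst hm
    simp at hy
    simp [hy]
  have hy' : (y : K) = algebraMap ℚ K ((n:ℚ)/m) := by
    have := congrArg (algebraMap (𝓞 K) K) hy
    have hm' : (m : K) ≠ 0 := by exact_mod_cast hm
    simp at this ⊢
    field_simp
    linear_combination -this
  have h1 : IsIntegral ℤ (y:K) := y.isIntegral_coe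
  rw [hy', isIntegral_algebraMap_iff (algebraMap ℚ K).injective] at h1
  obtain ⟨z, hz⟩ := IsIntegrallyClosed.isIntegral_iff.1 h1
  have hm' : (m : ℚ) ≠ 0 := by exact_mod_cast hm
  refine ⟨z, ?_⟩
  simp at hz
  field_simp at hz
  rw [mul_comm]; exact_mod_cast hz.symm

def bz (b : Bool) : ℤ := if b then 1 else 0
def bv (b0 b1 b2 b3 b4 b5 : Bool) : V6 := ⟨bz b0, bz b1, bz b2, bz b3, bz b4, bz b5⟩

lemma bz_emod (n : ℤ) : ∃ b : Bool, n % 2 = bz b := by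
  rcases Int.emod_two_eq_zero_or_one n with h | h
  · exact ⟨false, h⟩
  · exact ⟨true, h⟩

lemma bv_md (x : V6) : ∃ b0 b1 b2 b3 b4 b5 : Bool, md 2 x = bv b0 b1 b2 b3 b4 b5 := by
  obtain ⟨b0, h0⟩ := bz_emod x.a0
  obtain ⟨b1, h1⟩ := bz_emod x.a1
  obtain ⟨b2, h2⟩ := bz_emod x.a2
  obtain ⟨b3, h3⟩ := bz_emod x.b0
  obtain ⟨b4, h4⟩ := bz_emod x.b1
  obtain ⟨b5, h5⟩ := bz_emod x.b2
  exact ⟨b0,b1,b2,b3,b4,b5, by simp [md, bv, *]⟩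

lemma check2 : ∀ b0 b1 b2 b3 b4 b5 : Bool, bv b0 b1 b2 b3 b4 b5 = ⟨0,0,0,0,0,0⟩ ∨
   ∃ c0 c1 c2 c3 c4 c5 : Bool, md 2 (cm (bv b0 b1 b2 b3 b4 b5) (bv c0 c1 c2 c3 c4 c5)) = ⟨1,0,0,1,0,0⟩ := by
  decide +kernel

lemma FD.half (D : FD K) (w : 𝓞 K) (z : V6) (h : 2*w = D.E z) : ∃ t, w = D.E t := by
  obtain ⟨b0,b1,b2,b3,b4,b5,hb⟩ := bv_md z
  have hz := md_dv 2 z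
  rw [hb] at hz
  rcases check2 b0 b1 b2 b3 b4 b5 with h0 | ⟨c0,c1,c2,c3,c4,c5,hc⟩
  · refine ⟨dv 2 z, ?_⟩
    rw [h0] at hz
    rw [hz, D.E_add, D.E_sm] at h
    have e0 : D.E ⟨0,0,0,0,0,0⟩ = 0 := by simp [FD.E]
    rw [e0, zero_add] at h
    push_cast at h
    exact mul_left_cancel₀ two_ne_zero h
  · exfalso
    set c := bv c0 c1 c2 c3 c4 c5
    set b := bv b0 b1 b2 b3 b4 b5
    have h1 := md_dv 2 (cm b c)
    rw [hc] at h1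
    have h2 := D.E_mul b c
    rw [h1, D.E_add, D.E_sm] at h2
    have h3 : D.E z = D.E b + 2 * D.E (dv 2 z) := by
      conv_lhs => rw [hz, D.E_add, D.E_sm]
      push_cast; ring
    have e1 : D.E ⟨1,0,0,1,0,0⟩ = 1 + D.I := by simp [FD.E]
    rw [e1] at h2
    push_cast at h2
    obtain ⟨y, hy⟩ : ∃ y, 1 + D.I = 2*y := ⟨w * D.E c - D.E (dv 2 z) * D.E c - D.E (dv 2 (cm b c)), by
      linear_combination h2 - D.E c * h - D.E c * h3⟩
    have h5 : 2*(D.I) = 2*(2*y^2) := by linear_combination (1+D.I+2*y)*hy - D.hI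
    have h6 := mul_left_cancel₀ two_ne_zero h5
    have h7 : ((4:ℤ) : 𝓞 K) ∣ ((-1 : ℤ) : 𝓞 K) := ⟨y^4, by push_cast; linear_combination (D.I + 2*y^2)*h6 - D.hI⟩
    have := D.int_dvd h7
    norm_num at this

lemma FD.odd_index (D : FD K) (s : 𝓞 K) : ∃ (c : ℤ) (x : V6), c % 2 = 1 ∧ c * s = D.E x := by
  obtain ⟨N, x, hN, hx⟩ := D.E_span s
  have : ∀ n : ℕ, ∀ (N : ℤ) (x : V6), N.natAbs = n → N ≠ 0 → N * s = D.E x → ∃ (c : ℤ) (x : V6), c % 2 = 1 ∧ c * s = D.E x := by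
    intro n
    induction n using Nat.strong_induction_on with
    | _ n ih =>
      intro N x hn hN hx
      rcases Int.emod_two_eq_zero_or_one N with h | h
      · obtain ⟨M, rfl⟩ : ∃ M, N = 2*M := ⟨N/2, by omega⟩
        obtain ⟨t, ht⟩ := D.half (M*s) x (by rw [← hx]; push_cast; ring)
        exact ih M.natAbs (by omega) M t rfl (by omega) ht
      · exact ⟨N, x, h, hx⟩
  exact this _ N x rfl hN hx

end C9

namespace C9
open Polynomial NumberField Module
open V6
variable {K : Type} [Field K] [NumberField K]

def V6.get (x : V6) : Fin 6 → ℤ := ![x.a0, x.a1, x.a2, x.b0, x.b1, x.b2]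
def V6.e : Fin 6 → V6 := ![⟨1,0,0,0,0,0⟩, ⟨0,1,0,0,0,0⟩, ⟨0,0,1,0,0,0⟩, ⟨0,0,0,1,0,0⟩, ⟨0,0,0,0,1,0⟩, ⟨0,0,0,0,0,1⟩]
def V6.mat (x : V6) : Matrix (Fin 6) (Fin 6) ℤ := Matrix.of fun i j => (cm x (e j)).get i

lemma FD.b_eq (D : FD K) (j : Fin 6) : D.b j = (D.E (e j) : K) := by
  rw [D.hb]
  fin_cases j <;> simp [V6.e, FD.E]

lemma FD.repr_E (D : FD K) (x : V6) (i : Fin 6) : D.b.repr (D.E x : K) i = (x.get i : ℚ) := by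
  have h : (D.E x : K) = ∑ i, (x.get i : ℚ) • D.b i := by
    simp only [Fin.sum_univ_six, D.hb, Algebra.smul_def]
    simp only [FD.E, map_add, map_mul, map_pow, map_intCast, V6.get]
    simp
    ring
  rw [h, D.b.repr_sum_self]

lemma FD.leftMul (D : FD K) (x : V6) : Algebra.leftMulMatrix D.b (D.E x : K) = (x.mat).map (Int.castRingHom ℚ) := by
  ext i j
  rw [Algebra.leftMulMatrix_eq_repr_mul, D.b_eq, ← map_mul, ← D.E_mul, D.repr_E]
  rfl

lemma FD.normZ (D : FD K) (x : V6) : Algebra.norm ℤ (D.E x) = x.mat.det := by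
  have h := Algebra.coe_norm_int (D.E x)
  rw [Algebra.norm_eq_matrix_det D.b, D.leftMul, ← RingHom.mapMatrix_apply, ← RingHom.map_det, eq_intCast] at h
  exact_mod_cast h

lemma FD.traceZ (D : FD K) (x : V6) : Algebra.trace ℤ (𝓞 K) (D.E x) = x.mat.trace := by
  have h := Algebra.coe_trace_int (D.E x)
  rw [Algebra.trace_eq_matrix_trace D.b, D.leftMul] at h
  have h2 : ((x.mat).map (Int.castRingHom ℚ)).trace = ((x.mat.trace : ℤ) : ℚ) := by
    simp [Matrix.trace]
  rw [h2] at h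
  exact_mod_cast h

def Tm : Matrix (Fin 6) (Fin 6) ℤ := !![6, 2, -6, 0, 4, 0; 2, -6, -4, 4, 0, -4; -6, -4, -6, 0, -4, 0; 0, 4, 0, -6, -2, 6; 4, 0, -4, -2, 6, 4; 0, -4, 0, 6, 4, 6]

lemma Tm_eq : ∀ i j, (cm (e i) (e j)).mat.trace = Tm i j := by
  intro i j
  fin_cases i <;> fin_cases j <;> rfl
lemma Tm_det : Tm.det = -106560 := by decide +kernel

lemma FD.finrank (D : FD K) : Module.finrank ℚ K = 6 := by
  rw [Module.finrank_eq_card_basis D.b]; rfl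

lemma FD.discr_le (D : FD K) : |discr K| ≤ 106560 := by
  have hr : Module.finrank ℤ (𝓞 K) = 6 := by rw [RingOfIntegers.rank, D.finrank]
  let β := Module.finBasisOfFinrankEq ℤ (𝓞 K) hr
  have h1 : Algebra.discr ℤ (fun i => D.E (e i)) = -106560 := by
    rw [Algebra.discr_def, ← Tm_det]
    congr 1
    ext i j
    rw [Algebra.traceMatrix_apply, Algebra.traceForm_apply, ← D.E_mul, D.traceZ, Tm_eq]
  have h2 : (fun i => D.E (e i)) = Matrix.vecMul β ((β.toMatrix (fun i => D.E (e i))).map (algebraMap ℤ (𝓞 K))) := by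
    funext i
    have := β.sum_repr (D.E (e i))
    simp only [Matrix.vecMul, dotProduct, Matrix.map_apply, Basis.toMatrix_apply]
    refine this.symm.trans ?_
    apply Finset.sum_congr rfl
    intro j _
    rw [Algebra.smul_def, mul_comm]
  have h3 := Algebra.discr_of_matrix_vecMul β (β.toMatrix (fun i => D.E (e i)))
  rw [← h2, h1, discr_eq_discr] at h3
  have h4 : (β.toMatrix (fun i => D.E (e i))).det ≠ 0 := by
    intro h; rw [h] at h3; norm_num at h3
  have h5 : 1 ≤ (β.toMatrix (fun i => D.E (e i))).det^2 := by
    have := sq_pos_of_ne_zero h4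
    omega
  have h6 := congrArg abs h3
  rw [abs_mul, abs_of_pos (lt_of_lt_of_le one_pos h5)] at h6
  norm_num at h6
  nlinarith [abs_nonneg (discr K)]

lemma FD.tc (D : FD K) : InfinitePlace.nrRealPlaces K = 0 := by
  rw [nrRealPlaces_eq_zero_iff]
  constructor
  intro v
  by_contra hv
  rw [InfinitePlace.not_isComplex_iff_isReal] at hv
  have h := congrArg (fun z : 𝓞 K => (InfinitePlace.embedding_of_isReal hv) (z : K)) D.hI
  simp at h
  nlinarith [sq_nonneg ((InfinitePlace.embedding_of_isReal hv) (D.I : K))]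

lemma FD.nc (D : FD K) : InfinitePlace.nrComplexPlaces K = 3 := by
  have := InfinitePlace.card_add_two_mul_card_eq_rank K
  rw [D.tc, D.finrank] at this
  omega

lemma FD.mink (D : FD K) : (4 / Real.pi) ^ InfinitePlace.nrComplexPlaces K *
    ((Module.finrank ℚ K).factorial / (Module.finrank ℚ K) ^ (Module.finrank ℚ K) * √|(discr K : ℝ)|) < 11 := by
  rw [D.nc, D.finrank]
  have h1 : √|(discr K : ℝ)| ≤ 327 := by
    rw [Real.sqrt_le_left (by norm_num)]
    have := D.discr_le
    have h : (|discr K| : ℝ) ≤ 106560 := by exact_mod_cast this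
    linarith
  have h2 : (4 / Real.pi) ≤ 4/3.14 := by
    apply div_le_div_of_nonneg_left (by norm_num) (by norm_num) Real.pi_gt_d2.le
  have h3 : (4 / Real.pi)^3 ≤ (4/3.14)^3 := pow_le_pow_left₀ (by positivity) h2 3
  have h4 : (Nat.factorial 6 : ℝ) = 720 := by norm_num [Nat.factorial]
  rw [h4]
  push_cast
  calc _ ≤ (4/3.14 : ℝ)^3 * (720/6^6 * 327) := by gcongr
    _ < 11 := by norm_num

lemma eq_span_of_norm (P : Ideal (𝓞 K)) (π : 𝓞 K) (hπ : π ∈ P) (h : Ideal.absNorm P = (Algebra.norm ℤ π).natAbs)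
    (h0 : Ideal.absNorm P ≠ 0) : Submodule.IsPrincipal P := by
  refine ⟨⟨π, ?_⟩⟩
  rw [Ideal.submodule_span_eq]
  have hle : Ideal.span {π} ≤ P := (Ideal.span_singleton_le_iff_mem P).2 hπ
  obtain ⟨J, hJ⟩ := Ideal.dvd_iff_le.2 hle
  have hn := Ideal.absNorm_span_singleton π
  rw [hJ, map_mul, ← h] at hn
  have hJ1 : Ideal.absNorm J = 1 := by
    have := Nat.pos_of_ne_zero h0
    nlinarith
  rw [Ideal.absNorm_eq_one_iff] at hJ1
  rw [hJ, hJ1, Ideal.mul_top]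

lemma norms : (⟨1,0,0,1,0,0⟩ : V6).mat.det = 8 ∧ (⟨0,1,0,0,0,0⟩ : V6).mat.det = 5 ∧ (⟨-1,1,0,0,0,0⟩ : V6).mat.det = 5
   ∧ (⟨-1,1,0,-1,0,0⟩ : V6).mat.det = 9 ∧ (⟨1,1,0,1,0,0⟩ : V6).mat.det = 9 := by decide +kernel

/-- Algebra in a finite field of residue. -/
lemma FD.principal (D : FD K) (P : Ideal (𝓞 K)) (hP : P.IsPrime) (hP0 : P ≠ ⊥) (hn : Ideal.absNorm P < 11) :
    Submodule.IsPrincipal P := by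
  have hmax : P.IsMaximal := hP.isMaximal hP0
  let : Field (𝓞 K ⧸ P) := Ideal.Quotient.field P
  have h0 : Ideal.absNorm P ≠ 0 := by rwa [Ne, Ideal.absNorm_eq_zero_iff]
  have hfin : Finite (𝓞 K ⧸ P) := Ideal.finiteQuotientOfFreeOfNeBot P hP0
  let : Fintype (𝓞 K ⧸ P) := Fintype.ofFinite _
  have hcard : Fintype.card (𝓞 K ⧸ P) = Ideal.absNorm P := by
    rw [Ideal.absNorm_apply, Submodule.cardQuot_apply, ← Nat.card_eq_fintype_card]
  obtain ⟨p, hp⟩ := CharP.exists (𝓞 K ⧸ P)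
  obtain ⟨n, hpp, hpn⟩ := FiniteField.card (𝓞 K ⧸ P) p
  rw [hcard] at hpn
  have hpow : ∀ x : 𝓞 K ⧸ P, x ^ (Ideal.absNorm P) = x := by
    intro x; rw [← hcard]; exact FiniteField.pow_card x
  have hI := congrArg (Ideal.Quotient.mk P) D.hI
  have hτ := congrArg (Ideal.Quotient.mk P) D.hτ
  simp only [map_add, map_mul, map_sub, map_pow, map_one, map_neg, map_ofNat] at hI hτ
  have hpz : ((p:ℕ) : 𝓞 K ⧸ P) = 0 := CharP.cast_eq_zero _ p
  have hmem : ∀ x : V6, (Ideal.Quotient.mk P (D.E x) = 0) → (Ideal.absNorm P : ℤ) = x.mat.det → Submodule.IsPrincipal P := by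
    intro x hx hd
    refine eq_span_of_norm P (D.E x) (Ideal.Quotient.eq_zero_iff_mem.1 hx) ?_ h0
    rw [D.normZ, ← hd]; simp
  have hE : ∀ x : V6, Ideal.Quotient.mk P (D.E x) = x.a0 + x.a1*(Ideal.Quotient.mk P D.τ) + x.a2*(Ideal.Quotient.mk P D.τ)^2 + (Ideal.Quotient.mk P D.I)*(x.b0 + x.b1*(Ideal.Quotient.mk P D.τ) + x.b2*(Ideal.Quotient.mk P D.τ)^2) := by
    intro x
    simp only [FD.E, map_add, map_mul, map_pow, map_intCast]
  have hne : (1 : 𝓞 K ⧸ P) ≠ 0 := one_ne_zero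
  obtain ⟨n1, n2, n3, n4, n5⟩ := norms
  generalize (Ideal.Quotient.mk P) D.I = i at *
  generalize (Ideal.Quotient.mk P) D.τ = t at *
  have hp11 : p < 11 := lt_of_le_of_lt (Nat.le_self_pow n.pos.ne' p) (hpn ▸ hn)
  have hn4 : (n:ℕ) < 4 := by
    by_contra hc
    have := Nat.pow_le_pow_right hpp.pos (not_lt.1 hc)
    have := Nat.pow_le_pow_left hpp.two_le 4
    omega
  have hti := hpow t
  have hii := hpow i
  have hn1 := n.pos
  generalize (n:ℕ) = m at *
  rw [hpn] at hti hii hn hmem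
  clear hpow hpn
  interval_cases p <;> try (exfalso; revert hpp; decide)
  · -- p = 2
    push_cast at hpz
    have hi1 : i = 1 := by
      have : (i-1)^2 = 0 := by linear_combination hI - i*hpz
      have := pow_eq_zero_iff two_ne_zero |>.1 this
      linear_combination this
    subst hi1
    interval_cases m
    · exfalso; apply hne
      norm_num at hti
      grind
    · exfalso; apply hne
      norm_num at hti
      grind
    · apply hmem ⟨1,0,0,1,0,0⟩
      · rw [hE]; push_cast; linear_combination hpz
      · rw [n1]; norm_num
  · push_cast at hpz
    interval_cases m
    · exfalso; apply hne
      norm_num at hii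
      grind
    · have : (t-1-i)^2*(t+1+i) = 0 := by
        grind
      rcases mul_eq_zero.1 this with h | h
      · have h := pow_eq_zero_iff two_ne_zero |>.1 h
        apply hmem ⟨-1,1,0,-1,0,0⟩
        · rw [hE]; push_cast; linear_combination h
        · rw [n4]; norm_num
      · apply hmem ⟨1,1,0,1,0,0⟩
        · rw [hE]; push_cast; linear_combination h
        · rw [n5]; norm_num
    · exfalso; norm_num at hn
  · push_cast at hpz
    interval_cases m
    · have h2 : (i-2)*(i-3) = 0 := by grind
      rcases mul_eq_zero.1 h2 with h | h
      · have h3 : t*(t-1)^2 = 0 := by grind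
        rcases mul_eq_zero.1 h3 with h | h
        · apply hmem ⟨0,1,0,0,0,0⟩
          · rw [hE]; push_cast; linear_combination h
          · rw [n2]; norm_num
        · have h := pow_eq_zero_iff two_ne_zero |>.1 h
          apply hmem ⟨-1,1,0,0,0,0⟩
          · rw [hE]; push_cast; linear_combination h
          · rw [n3]; norm_num
      · exfalso; apply hne
        norm_num at hti
        grind
    · exfalso; norm_num at hn
    · exfalso; norm_num at hn
  · push_cast at hpz
    interval_cases m
    · exfalso; apply hne
      norm_num at hii
      grind
    · exfalso; norm_num at hn
    · exfalso; norm_num at hn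

theorem FD.pid (D : FD K) : IsPrincipalIdealRing (𝓞 K) := by
  apply RingOfIntegers.isPrincipalIdealRing_of_isPrincipal_of_norm_le_of_isPrime
  intro P hP hle
  refine D.principal P hP (nonZeroDivisors.coe_ne_zero P) ?_
  have := lt_of_le_of_lt hle D.mink
  exact_mod_cast this
end C9

namespace C9
open Polynomial NumberField Module
open V6
variable {K : Type} [Field K] [NumberField K]

def uV (a b c : Bool) : V6 :=
  cm (cm (if a then ⟨0,0,0,1,0,0⟩ else ⟨1,0,0,0,0,0⟩) (if b then ⟨0,1,0,1,0,0⟩ else ⟨1,0,0,0,0,0⟩))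
    (if c then ⟨-1,1,0,1,0,0⟩ else ⟨1,0,0,0,0,0⟩)

def tI (z : V6) : Prop := z.a0 % 2 = 1 ∧ z.a1 % 2 = 0 ∧ z.a2 % 2 = 0 ∧ z.b0 % 4 = 0 ∧ z.b1 % 4 = 0 ∧ z.b2 % 4 = 0
def tII (z : V6) : Prop := z.a0 % 2 = 1 ∧ z.a1 % 2 = 1 ∧ z.a2 % 2 = 1 ∧ z.b0 % 4 = 0 ∧ z.b1 % 4 = 0 ∧ z.b2 % 4 = 0
instance : DecidablePred tI := fun z => by unfold tI; infer_instance
instance : DecidablePred tII := fun z => by unfold tII; infer_instance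

def cI (a b c : Bool) (s z : V6) : Prop := a = false ∧ b = false ∧ c = false ∧
  ((z.a0 % 4 = 3 ∧ z.a1 % 4 = 0 ∧ z.a2 % 4 = 0 ∧ s = ⟨0,0,0,1,0,0⟩) ∨ (z.a0 % 4 = 1 ∧ z.a1 % 4 = 0 ∧ z.a2 % 4 = 0 ∧ s = ⟨1,0,0,0,0,0⟩))
def cII (a b c : Bool) (s z : V6) : Prop := a = false ∧ b = false ∧ c = false ∧
  ((z.a0 % 4 = 3 ∧ z.a1 % 4 = 1 ∧ z.a2 % 4 = 3 ∧ s = ⟨1,1,0,1,1,1⟩) ∨ (z.a0 % 4 = 1 ∧ z.a1 % 4 = 3 ∧ z.a2 % 4 = 1 ∧ s = ⟨1,1,1,1,1,0⟩))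
instance (a b c : Bool) (s z : V6) : Decidable (cI a b c s z) := by unfold cI; infer_instance
instance (a b c : Bool) (s z : V6) : Decidable (cII a b c s z) := by unfold cII; infer_instance

lemma check4 : ∀ a b c b0 b1 b2 b3 b4 b5 : Bool,
   (tI (cm (uV a b c) (cm (bv b0 b1 b2 b3 b4 b5) (bv b0 b1 b2 b3 b4 b5))) →
    cI a b c (bv b0 b1 b2 b3 b4 b5) (cm (uV a b c) (cm (bv b0 b1 b2 b3 b4 b5) (bv b0 b1 b2 b3 b4 b5)))) ∧
   (tII (cm (uV a b c) (cm (bv b0 b1 b2 b3 b4 b5) (bv b0 b1 b2 b3 b4 b5))) →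
    cII a b c (bv b0 b1 b2 b3 b4 b5) (cm (uV a b c) (cm (bv b0 b1 b2 b3 b4 b5) (bv b0 b1 b2 b3 b4 b5)))) := by
  decide +kernel

lemma cm_sq4 (u s t : V6) : cm u (cm (add s (sm 2 t)) (add s (sm 2 t))) =
    add (cm u (cm s s)) (sm 4 (cm u (add (cm s t) (cm t t)))) := by
  ext <;> simp only [cm, add, sm] <;> ring

lemma mod4 (a b c : Bool) (S : V6) :
   (tI (cm (uV a b c) (cm S S)) → cI a b c (md 2 S) (cm (uV a b c) (cm S S))) ∧
   (tII (cm (uV a b c) (cm S S)) → cII a b c (md 2 S) (cm (uV a b c) (cm S S))) := by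
  obtain ⟨b0,b1,b2,b3,b4,b5,hb⟩ := bv_md S
  have h := cm_sq4 (uV a b c) (md 2 S) (dv 2 S)
  rw [← md_dv 2 S] at h
  obtain ⟨c1, c2⟩ := check4 a b c b0 b1 b2 b3 b4 b5
  rw [← hb] at c1 c2
  generalize cm (uV a b c) (cm S S) = z at *
  generalize cm (uV a b c) (cm (md 2 S) (md 2 S)) = w at *
  have e0 : z.a0 % 4 = w.a0 % 4 := by rw [h]; simp [add, sm]
  have e1 : z.a1 % 4 = w.a1 % 4 := by rw [h]; simp [add, sm]
  have e2 : z.a2 % 4 = w.a2 % 4 := by rw [h]; simp [add, sm]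
  have e3 : z.b0 % 4 = w.b0 % 4 := by rw [h]; simp [add, sm]
  have e4 : z.b1 % 4 = w.b1 % 4 := by rw [h]; simp [add, sm]
  have e5 : z.b2 % 4 = w.b2 % 4 := by rw [h]; simp [add, sm]
  refine ⟨fun ht => ?_, fun ht => ?_⟩
  · have : tI w := by unfold tI at *; omega
    have := c1 this
    unfold cI at *
    rw [e0, e1, e2]; exact this
  · have : tII w := by unfold tII at *; omega
    have := c2 this
    unfold cII at *
    rw [e0, e1, e2]; exact this

def FD.Iu (D : FD K) : (𝓞 K)ˣ := ⟨D.I, -D.I, by linear_combination -D.hI, by linear_combination -D.hI⟩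

def FD.mkU (D : FD K) (x y : V6) (h : cm x y = ⟨1,0,0,0,0,0⟩) : (𝓞 K)ˣ :=
  ⟨D.E x, D.E y, by rw [← D.E_mul, h]; simp [FD.E], by rw [mul_comm, ← D.E_mul, h]; simp [FD.E]⟩

def FD.U1 (D : FD K) : (𝓞 K)ˣ := D.mkU ⟨0,1,0,1,0,0⟩ ⟨1,-1,0,1,-1,1⟩ rfl
def FD.U2 (D : FD K) : (𝓞 K)ˣ := D.mkU ⟨-1,1,0,1,0,0⟩ ⟨-1,0,-1,1,-1,0⟩ rfl
def FD.U0 (D : FD K) : (𝓞 K)ˣ := D.mkU ⟨0,0,0,1,0,0⟩ ⟨0,0,0,-1,0,0⟩ rfl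

def FD.U (D : FD K) (a b c : Bool) : (𝓞 K)ˣ := (if a then D.U0 else 1) * (if b then D.U1 else 1) * (if c then D.U2 else 1)

lemma FD.E_one (D : FD K) : D.E ⟨1,0,0,0,0,0⟩ = 1 := by simp [FD.E]

lemma FD.U_coe (D : FD K) (a b c : Bool) : (D.U a b c : 𝓞 K) = D.E (uV a b c) := by
  simp only [FD.U, uV, D.E_mul, Units.val_mul]
  congr 1
  · congr 1
    · cases a
      · simp [D.E_one]
      · rfl
    · cases b
      · simp [D.E_one]
      · rfl
  · cases c
    · simp [D.E_one]
    · rfl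

lemma cg1 {G : Type*} [CommGroup G] (a b c a' b' c' : G) : a*b*c*(a'*b'*c') = (a*a')*(b*b')*(c*c') := by
  rw [mul_mul_mul_comm, mul_mul_mul_comm a]

lemma FD.U_xor (D : FD K) (a b c a' b' c' : Bool) : ∃ r, D.U a b c * D.U a' b' c' = D.U (xor a a') (xor b b') (xor c c') * r^2 := by
  refine ⟨(if a && a' then D.U0 else 1) * (if b && b' then D.U1 else 1) * (if c && c' then D.U2 else 1), ?_⟩
  have h : ∀ (a a' : Bool) (x : (𝓞 K)ˣ), (if a then x else 1) * (if a' then x else 1) = (if xor a a' then x else 1) * (if a && a' then x else 1)^2 := by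
    intro a a' x
    cases a <;> cases a' <;> simp [sq]
  have h0 := h a a' D.U0
  have h1 := h b b' D.U1
  have h2 := h c c' D.U2
  unfold FD.U
  calc _ = ((if a then D.U0 else 1) * (if a' then D.U0 else 1)) * ((if b then D.U1 else 1) * (if b' then D.U1 else 1)) * ((if c then D.U2 else 1) * (if c' then D.U2 else 1)) := by
          exact cg1 _ _ _ _ _ _
    _ = _ := by rw [h0, h1, h2, mul_pow, mul_pow]; exact (cg1 _ _ _ _ _ _).symm

lemma FD.U_sq (D : FD K) (a b c : Bool) (w : (𝓞 K)ˣ) (h : D.U a b c = w^2) : a = false ∧ b = false ∧ c = false := by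
  obtain ⟨n, S, hn, hS⟩ := D.odd_index ((w⁻¹ : (𝓞 K)ˣ) : 𝓞 K)
  have h1 : D.E (cm (uV a b c) (cm S S)) = D.E ⟨n^2,0,0,0,0,0⟩ := by
    rw [D.E_mul, D.E_mul, ← D.U_coe, ← hS, h]
    have : (w : 𝓞 K) * ((w⁻¹ : (𝓞 K)ˣ) : 𝓞 K) = 1 := by simp
    simp only [FD.E]
    push_cast
    linear_combination (n:𝓞 K)^2 * ((w : 𝓞 K) * ((w⁻¹ : (𝓞 K)ˣ) : 𝓞 K) + 1) * this
  have h2 := D.E_inj h1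
  have h3 := (mod4 a b c S).1
  rw [h2] at h3
  have := h3 (by
    refine ⟨?_, rfl, rfl, rfl, rfl, rfl⟩
    simp only []
    rw [sq, Int.mul_emod, hn]; rfl)
  exact ⟨this.1, this.2.1, this.2.2.1⟩

lemma zpow_bool {G : Type*} [CommGroup G] (q : G) (h : q^2 = 1) (n : ℤ) : ∃ b : Bool, q^n = if b then q else 1 := by
  have h2 : q^(2:ℤ) = 1 := by exact_mod_cast h
  rcases Int.even_or_odd' n with ⟨k, rfl | rfl⟩
  · refine ⟨false, ?_⟩
    rw [zpow_mul, h2]; simp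
  · refine ⟨true, ?_⟩
    rw [zpow_add, zpow_mul, h2]; simp

theorem FD.units (D : FD K) (u : (𝓞 K)ˣ) : ∃ (a b c : Bool) (r : (𝓞 K)ˣ), u = D.U a b c * r^2 := by
  classical
  let H : Subgroup (𝓞 K)ˣ := (powMonoidHom 2 : (𝓞 K)ˣ →* (𝓞 K)ˣ).range
  have hH : ∀ x, x^2 ∈ H := fun x => ⟨x, rfl⟩
  let Q := (𝓞 K)ˣ ⧸ H
  have hsq : ∀ q : Q, q^2 = 1 := by
    intro q
    induction q using QuotientGroup.induction_on with
    | H x => rw [← QuotientGroup.mk_pow]; exact (QuotientGroup.eq_one_iff _).2 (hH x)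
  have hz : ∀ (q : Q) (n : ℤ), ∃ b : Bool, q^n = if b then q else 1 := fun q n => zpow_bool q (hsq q) n
  obtain ⟨ζ, hζ⟩ := IsCyclic.exists_generator (α := Units.torsion K)
  let ψ : Bool × (Fin (Units.rank K) → Bool) → Q := fun p =>
    (if p.1 then ((ζ : (𝓞 K)ˣ) : Q) else 1) * ∏ i, (if p.2 i then ((Units.fundSystem K i : (𝓞 K)ˣ) : Q) else 1)
  have hψ : Function.Surjective ψ := by
    intro q
    induction q using QuotientGroup.induction_on with
    | H x =>
      obtain ⟨⟨z, e⟩, hx, -⟩ := Units.exist_unique_eq_mul_prod K x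
      obtain ⟨n, hn⟩ := Subgroup.mem_zpowers_iff.1 (hζ z)
      obtain ⟨b, hb⟩ := hz ((ζ : (𝓞 K)ˣ) : Q) n
      choose B hB using fun i => hz ((Units.fundSystem K i : (𝓞 K)ˣ) : Q) (e i)
      refine ⟨(b, B), ?_⟩
      simp only [ψ]
      rw [← hb]
      simp only [← hB]
      rw [hx, ← hn]
      have hmap := map_mul (QuotientGroup.mk' H) ((ζ^n : Units.torsion K) : (𝓞 K)ˣ) (∏ i, Units.fundSystem K i ^ e i)
      simp only [map_prod, map_zpow, Subgroup.coe_zpow] at hmap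
      exact hmap.symm
  have hrank : Units.rank K = 2 := by
    unfold Units.rank
    rw [InfinitePlace.card_eq_nrRealPlaces_add_nrComplexPlaces, D.tc, D.nc]
  have hfin : Finite Q := Finite.of_surjective ψ hψ
  have hcard : Nat.card Q ≤ 8 := by
    have := Nat.card_le_card_of_surjective ψ hψ
    rw [Nat.card_eq_fintype_card (α := Bool × (Fin (Units.rank K) → Bool))] at this
    simpa [hrank] using this
  let φ : Bool × Bool × Bool → Q := fun p => ((D.U p.1 p.2.1 p.2.2 : (𝓞 K)ˣ) : Q)
  have hφ : Function.Injective φ := by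
    rintro ⟨a,b,c⟩ ⟨a',b',c'⟩ h
    simp only [φ] at h
    rw [QuotientGroup.eq] at h
    obtain ⟨w, hw⟩ := h
    change w^2 = _ at hw
    obtain ⟨r, hr⟩ := D.U_xor a b c a' b' c'
    have : D.U (xor a a') (xor b b') (xor c c') = (w * D.U a b c * r⁻¹)^2 := by
      have h1 : D.U (xor a a') (xor b b') (xor c c') = D.U a b c * D.U a' b' c' * (r^2)⁻¹ := by
        rw [hr]; simp
      have h2 : D.U a' b' c' = D.U a b c * w^2 := by rw [hw]; simp
      rw [h1, h2, mul_pow, mul_pow, inv_pow]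
      simp only [sq, mul_comm, mul_left_comm]
    obtain ⟨h1, h2, h3⟩ := D.U_sq _ _ _ _ this
    simp at h1 h2 h3
    simp [h1, h2, h3]
  have hsurj : Function.Surjective φ := by
    let : Fintype Q := Fintype.ofFinite Q
    refine ((Fintype.bijective_iff_injective_and_card φ).2 ⟨hφ, ?_⟩).2
    have h1 := Fintype.card_le_of_injective φ hφ
    rw [Nat.card_eq_fintype_card] at hcard
    simp at h1 ⊢
    omega
  obtain ⟨⟨a,b,c⟩, h⟩ := hsurj (u : Q)
  simp only [φ] at h
  rw [QuotientGroup.eq] at h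
  obtain ⟨w, hw⟩ := h
  change w^2 = _ at hw
  exact ⟨a, b, c, w, by rw [hw]; simp⟩
end C9

namespace C9
set_option linter.unusedSectionVars false
open Polynomial NumberField Module
open V6

section dom
variable {F : Type} [CommRing F] [IsDomain F] (p : ℕ) [hp : Fact p.Prime] [CharP F p] (t : F)

lemma lin_case (r : ℤ) (hr : t = (r:F)) (hf : ¬ (p:ℤ)^2 ∣ fZ.eval r) (a b k : ℤ[X]) (c : ℤ) (hc : ¬ (p:ℤ) ∣ c)
    (h : C c^2 * fZ = b^2 + a*k) (ha : aeval t a = 0) (hb : aeval t b = 0) (hk : aeval t k = 0) : False := by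
  have key : ∀ q : ℤ[X], aeval t q = 0 → (p:ℤ) ∣ q.eval r := by
    intro q hq
    rw [hr] at hq
    have : aeval (algebraMap ℤ F r) q = algebraMap ℤ F (q.eval r) := aeval_algebraMap_apply_eq_algebraMap_eval r q
    simp only [algebraMap_int_eq, eq_intCast] at this
    rw [this] at hq
    exact (CharP.intCast_eq_zero_iff F p _).1 hq
  obtain ⟨a', ha'⟩ := key a ha
  obtain ⟨b', hb'⟩ := key b hb
  obtain ⟨k', hk'⟩ := key k hk
  have h2 := congrArg (eval r) h
  simp only [eval_mul, eval_add, eval_pow, eval_C, ha', hb', hk'] at h2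
  have h3 : (p:ℤ)^2 ∣ c^2 * fZ.eval r := ⟨b'^2 + a'*k', by rw [h2]; ring⟩
  have hpp : Prime (p:ℤ) := Nat.prime_iff_prime_int.1 hp.out
  have hcop : IsCoprime ((p:ℤ)^2) (c^2) := (hpp.coprime_iff_not_dvd.2 hc).pow
  exact hf (hcop.dvd_of_dvd_mul_left h3)

lemma three_case (hp3 : p = 3) (ht : (t-1)^2 = -1) (a b k : ℤ[X]) (c : ℤ) (hc : ¬ (p:ℤ) ∣ c)
    (h : C c^2 * fZ = b^2 + a*k) (ha : aeval t a = 0) (hb : aeval t b = 0) (hk : aeval t k = 0) : False := by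
  subst hp3
  let θ : GaussianInt →+* F := Zsqrtd.lift ⟨t-1, by push_cast; linear_combination ht⟩
  let r : GaussianInt := ⟨1,1⟩
  have hθr : θ r = t := by simp [θ, r, Zsqrtd.lift]
  have key : ∀ q : ℤ[X], aeval t q = 0 → ∃ z, aeval r q = 3 * z := by
    intro q hq
    have h1 : θ (aeval r q) = 0 := by
      rw [← hθr] at hq
      rw [← hq]
      have := Polynomial.hom_eval₂ q (algebraMap ℤ GaussianInt) θ r
      rw [aeval_def, this, aeval_def]
      congr 1
      exact Subsingleton.elim _ _
    obtain ⟨z, hz⟩ : ∃ z, z = aeval r q := ⟨_, rfl⟩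
    rw [← hz] at h1 ⊢
    obtain ⟨m, n⟩ := z
    have h2 : θ ((⟨m,n⟩ : GaussianInt) * ⟨m,-n⟩) = 0 := by rw [map_mul, h1, zero_mul]
    have h3 : (⟨m,n⟩ : GaussianInt) * ⟨m,-n⟩ = ((m^2+n^2 : ℤ) : GaussianInt) := by
      ext <;> simp only [Zsqrtd.re_mul, Zsqrtd.im_mul, Zsqrtd.re_intCast, Zsqrtd.im_intCast] <;> ring
    rw [h3, map_intCast, CharP.intCast_eq_zero_iff F 3] at h2
    have h4 : m % 3 = 0 ∧ n % 3 = 0 := by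
      have : (m^2+n^2) % 3 = 0 := by exact Int.emod_eq_zero_of_dvd h2
      rcases (by omega : m % 3 = 0 ∨ m % 3 = 1 ∨ m % 3 = 2) with h | h | h <;>
      rcases (by omega : n % 3 = 0 ∨ n % 3 = 1 ∨ n % 3 = 2) with h' | h' | h' <;>
      simp [sq, Int.add_emod, Int.mul_emod, h, h'] at this ⊢
    exact ⟨⟨m/3, n/3⟩, by ext <;> simp <;> omega⟩
  obtain ⟨a', ha'⟩ := key a ha
  obtain ⟨b', hb'⟩ := key b hb
  obtain ⟨k', hk'⟩ := key k hk
  have h2 := congrArg (aeval r) h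
  have hfr : aeval r fZ = -3 := by
    simp only [fZ, map_add, map_sub, map_mul, map_pow, aeval_X, map_ofNat]
    decide +kernel
  rw [map_add, map_mul, map_mul, map_pow, map_pow, hfr, ha', hb', hk', aeval_C] at h2
  have h3 : (algebraMap ℤ GaussianInt c)^2 = 3 * -(b'^2+a'*k') := by
    have : (3:GaussianInt) ≠ 0 := by decide
    apply mul_left_cancel₀ this
    linear_combination -h2
  have h4 := congrArg Zsqrtd.re h3
  have h5 : ((algebraMap ℤ GaussianInt c)^2).re = c^2 := by
    simp [sq]
  rw [h5] at h4
  have h6 : (3 * -(b'^2+a'*k')).re = 3 * (-(b'^2+a'*k')).re := by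
    have : (3 : GaussianInt) = ((3:ℤ):GaussianInt) := by norm_num
    rw [this, Zsqrtd.re_smul]
  rw [h6] at h4
  have hpp : Prime (3:ℤ) := Int.prime_three
  exact hc (by exact_mod_cast hpp.dvd_of_dvd_pow ⟨_, h4⟩)

lemma bez_case (hp2 : p ≠ 2) (hft : aeval t fZ = 0) (a b k : ℤ[X]) (c : ℤ) (hc : ¬ (p:ℤ) ∣ c)
    (h : C c^2 * fZ = b^2 + a*k) (ha : aeval t a = 0) (hb : aeval t b = 0) (hk : aeval t k = 0) : False := by
  have hd : aeval t (derivative fZ) = 0 := by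
    have h1 := congrArg (fun q => aeval t (derivative q)) h
    simp only [derivative_add, derivative_mul, derivative_pow, derivative_C, map_add, map_mul, map_pow, aeval_C, ha, hb, hk, hft] at h1
    simp at h1
    rcases h1 with h1 | h1
    · exact absurd ((CharP.intCast_eq_zero_iff F p c).1 h1) hc
    · exact h1
  simp only [fZ, derivative_add, derivative_sub, derivative_mul, derivative_pow, derivative_X, derivative_ofNat, map_add, map_sub, map_mul, map_pow, aeval_X, map_ofNat] at hd
  simp only [fZ, map_add, map_sub, map_mul, map_pow, aeval_X, map_ofNat] at hft
  simp at hd hft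
  simp only [map_ofNat] at hd
  have hN : (4440 : F) = 0 := by
    linear_combination (816 - 164*t + 2442*t^2 - 338*t^3 + 1362*t^4)*hft + (-45 - 1031*t + 234*t^2 - 678*t^3+132*t^4 - 227*t^5)*hd
  have hN' : p ∣ 4440 := by
    have : ((4440:ℕ):F) = 0 := by exact_mod_cast hN
    exact (CharP.cast_eq_zero_iff F p _).1 this
  have hps : p = 3 ∨ p = 5 ∨ p = 37 := by
    have h1 : p ∣ 2^3 * (3 * (5 * 37)) := by norm_num; exact hN'
    have pp := hp.out
    rcases pp.dvd_mul.1 h1 with h1 | h1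
    · exact absurd ((Nat.prime_dvd_prime_iff_eq pp Nat.prime_two).1 (pp.dvd_of_dvd_pow h1)) hp2
    rcases pp.dvd_mul.1 h1 with h1 | h1
    · left; exact (Nat.prime_dvd_prime_iff_eq pp (by norm_num)).1 h1
    rcases pp.dvd_mul.1 h1 with h1 | h1
    · right; left; exact (Nat.prime_dvd_prime_iff_eq pp (by norm_num)).1 h1
    · right; right; exact (Nat.prime_dvd_prime_iff_eq pp (by norm_num)).1 h1
  have hp0 : (p:F) = 0 := CharP.cast_eq_zero F p
  rcases hps with h3 | h3 | h3
  · apply three_case p t h3 _ a b k c hc h ha hb hk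
    have hp0 : (3:F) = 0 := by rw [h3] at hp0; exact_mod_cast hp0
    linear_combination -hft + (1-t^2)*hd + (-(-4 + 9*t - 7*t^2 + 2*t^3+t^4 - 4*t^5+3*t^6 - 2*t^7) - t + 1)*hp0
  · refine lin_case p t 1 ?_ ?_ a b k c hc h ha hb hk
    · have hp0 : (5:F) = 0 := by rw [h3] at hp0; exact_mod_cast hp0
      push_cast
      linear_combination (1+2*t-t^2-2*t^3)*hft + (2+2*t+t^2+2*t^3+2*t^4)*hd - (-2+5*t-3*t^2+4*t^3+5*t^4+2*t^5+2*t^6+4*t^7-t^8+2*t^9)*hp0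
    · rw [h3]; simp [fZ]
  · refine lin_case p t (-17) ?_ ?_ a b k c hc h ha hb hk
    · have hp0 : (37:F) = 0 := by rw [h3] at hp0; exact_mod_cast hp0
      push_cast
      linear_combination (-13+5*t+9*t^2-11*t^3)*hft + (-1-5*t-12*t^2+2*t^3+8*t^4)*hd - (-2+4*t-3*t^2-5*t^3+5*t^4-5*t^5+2*t^6-t^8+t^9)*hp0
    · rw [h3]; simp [fZ]

lemma fp_dvd (a b k : (ZMod p)[X]) (ha0 : a ≠ 0) (hda : a.natDegree ≤ 2) (h : b^2 + a*k = 0)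
    (φ : (ZMod p)[X] →+* F) (ha : φ a = 0) (hk : φ k = 0) : a ∣ b := by
  have hdvd : a ∣ b^2 := ⟨-k, by linear_combination h⟩
  by_cases hs : Squarefree a
  · exact (hs.dvd_pow_iff_dvd two_ne_zero).1 hdvd
  · unfold Squarefree at hs
    push Not at hs
    obtain ⟨d, ⟨e, he⟩, hd⟩ := hs
    have hd0 : d ≠ 0 := by rintro rfl; simp at he; exact ha0 he
    have he0 : e ≠ 0 := by rintro rfl; simp at he; exact ha0 he
    have hdd : 1 ≤ d.natDegree := by
      by_contra hh
      apply hd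
      have : d.natDegree = 0 := by omega
      rw [eq_C_of_natDegree_eq_zero this] at hd0 ⊢
      exact isUnit_C.2 (isUnit_iff_ne_zero.2 (by simpa using hd0))
    have hdeg : d.natDegree + d.natDegree + e.natDegree ≤ 2 := by
      rw [he, natDegree_mul (mul_ne_zero hd0 hd0) he0, natDegree_mul hd0 hd0] at hda
      exact hda
    have hed : e.natDegree = 0 := by omega
    have hd1 : d.natDegree = 1 := by omega
    have heu : IsUnit e := by
      rw [eq_C_of_natDegree_eq_zero hed] at he0 ⊢
      exact isUnit_C.2 (isUnit_iff_ne_zero.2 (by simpa using he0))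
    have hφd : φ d = 0 := by
      rw [he, map_mul, map_mul] at ha
      have : φ e ≠ 0 := (heu.map φ).ne_zero
      simpa [this] using ha
    have hdb : d ∣ b := by
      have : d^2 ∣ b^2 := ⟨-e*k, by rw [he] at h; linear_combination h⟩
      exact (IsIntegrallyClosed.pow_dvd_pow_iff two_ne_zero).1 this
    obtain ⟨b1, rfl⟩ := hdb
    have hb1 : b1^2 = -e*k := by
      apply mul_left_cancel₀ (pow_ne_zero 2 hd0)
      rw [he] at h; linear_combination h
    have hφb : φ b1 = 0 := by
      have : φ (b1^2) = 0 := by rw [hb1, map_mul, hk, mul_zero]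
      rw [map_pow] at this
      exact pow_eq_zero_iff two_ne_zero |>.1 this
    have hdb1 : d ∣ b1 := by
      have h1 := EuclideanDomain.div_add_mod b1 d
      have h2 : (b1 % d).natDegree = 0 := by
        have := Polynomial.natDegree_mod_lt b1 (q := d) (by omega)
        omega
      have h3 : φ (b1 % d) = 0 := by
        have := congrArg φ h1
        rw [map_add, map_mul, hφd, zero_mul, zero_add, hφb] at this
        exact this
      have h4 : b1 % d = 0 := by
        rw [eq_C_of_natDegree_eq_zero h2] at h3 ⊢
        have : Function.Injective (φ.comp C) := RingHom.injective _
        have := this (a₁ := (b1 % d).coeff 0) (a₂ := 0) (by rw [RingHom.comp_apply, h3, map_zero])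
        rw [this, C_0]
      exact ⟨b1 / d, by rw [h4, add_zero] at h1; exact h1.symm⟩
    rw [he]
    exact heu.mul_right_dvd.2 (mul_dvd_mul_left d hdb1)

lemma map_zero_dvd (q : ℤ[X]) (h : q.map (Int.castRingHom (ZMod p)) = 0) : C (p:ℤ) ∣ q := by
  rw [C_dvd_iff_dvd_coeff]
  intro i
  have := congrArg (fun s => coeff s i) h
  simp only [coeff_map, coeff_zero, eq_intCast] at this
  exact (ZMod.intCast_zmod_eq_zero_iff_dvd _ _).1 this

theorem descent (hp2 : p ≠ 2) (hft : aeval t fZ = 0) (a : ℤ[X]) (hda : a.natDegree ≤ 2)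
    (hap : ¬ C (p:ℤ) ∣ a) (ha : aeval t a = 0)
    (H : ∀ (c : ℤ) (b k : ℤ[X]), C c^2 * fZ = b^2 + a*k → aeval t b = 0 ∧ aeval t k = 0) :
    ∀ (n : ℕ) (c : ℤ) (b k : ℤ[X]), c ≠ 0 → c.natAbs ≤ n → C c^2 * fZ = b^2 + a*k → False := by
  intro n
  induction n with
  | zero => intro c b k hc hn; omega
  | succ n ih =>
    intro c b k hc hn h
    obtain ⟨hb, hk⟩ := H c b k h
    by_cases hpc : (p:ℤ) ∣ c
    swap
    · exact bez_case p t hp2 hft a b k c hpc h ha hb hk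
    obtain ⟨c1, rfl⟩ := hpc
    let φ : (ZMod p)[X] →+* F := eval₂RingHom (ZMod.castHom (dvd_refl p) F) t
    have hφ : ∀ q : ℤ[X], φ (q.map (Int.castRingHom (ZMod p))) = aeval t q := by
      intro q
      simp only [φ, coe_eval₂RingHom, eval₂_map, aeval_def]
      congr 1
      exact Subsingleton.elim _ _
    have hm := congrArg (Polynomial.map (Int.castRingHom (ZMod p))) h
    simp only [Polynomial.map_mul, Polynomial.map_add, Polynomial.map_pow, map_C] at hm
    have hp0 : (Int.castRingHom (ZMod p)) ((p:ℤ) * c1) = 0 := by simp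
    rw [hp0] at hm
    simp at hm
    have hdv := fp_dvd p _ _ _ (fun h0 => hap (map_zero_dvd p a h0)) (natDegree_map_le.trans hda) hm.symm φ
      (by rw [hφ, ha]) (by rw [hφ, hk])
    obtain ⟨e', he'⟩ := hdv
    obtain ⟨e, rfl⟩ := Polynomial.map_surjective (Int.castRingHom (ZMod p)) (ZMod.ringHom_surjective _) e'
    obtain ⟨b1, hb1⟩ := map_zero_dvd p (b - a*e) (by rw [Polynomial.map_sub, Polynomial.map_mul, he', sub_self])
    have hpp : Prime (p:ℤ) := Nat.prime_iff_prime_int.1 hp.out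
    have hcp : Prime (C (p:ℤ)) := prime_C_iff.2 hpp
    have hb' : b = a*e + C (p:ℤ)*b1 := by linear_combination hb1
    rw [C_mul] at h
    have h5 : C (p:ℤ)^2 ∣ (k + a*e^2 + 2*C (p:ℤ)*b1*e) * a :=
      ⟨C c1^2*fZ - b1^2, by rw [hb'] at h; linear_combination -h⟩
    obtain ⟨k1, hk1⟩ := hcp.pow_dvd_of_dvd_mul_right 2 hap h5
    have hpn : (C (p:ℤ))^2 ≠ 0 := pow_ne_zero 2 hcp.ne_zero
    refine ih c1 b1 k1 (by rintro rfl; simp at hc) ?_ ?_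
    · rw [Int.natAbs_mul] at hn
      have h1 : c1.natAbs ≠ 0 := by
        intro h0; rw [Int.natAbs_eq_zero] at h0; rw [h0] at hc; simp at hc
      have := hp.out.two_le
      simp at hn
      nlinarith [Nat.pos_of_ne_zero h1]
    · apply mul_left_cancel₀ hpn
      rw [hb'] at h
      linear_combination h + a * hk1
end dom
end C9

namespace C9
open Polynomial NumberField Module
open V6
variable {K : Type} [Field K] [NumberField K]

noncomputable def aP (α β γ : ℤ) : ℤ[X] := C α + C β * X + C γ * X^2

structure Data (α β γ : ℤ) : Prop where
  cop : ∀ d : ℤ, d ∣ α → d ∣ β → d ∣ γ → IsUnit d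
  ex : ∃ (c : ℤ) (b k : ℤ[X]), c % 2 = 1 ∧ b.natDegree ≤ 3 ∧ k.natDegree ≤ 4 ∧ C c^2 * fZ = b^2 + aP α β γ * k

lemma aP_natDegree (α β γ : ℤ) : (aP α β γ).natDegree ≤ 2 := by
  unfold aP; compute_degree

lemma aP_dvd (α β γ d : ℤ) (h : C d ∣ aP α β γ) : d ∣ α ∧ d ∣ β ∧ d ∣ γ := by
  rw [C_dvd_iff_dvd_coeff] at h
  have h0 := h 0
  have h1 := h 1
  have h2 := h 2
  simp [aP, coeff_X, coeff_X_pow, -eq_intCast, -map_intCast, coeff_C] at h0 h1 h2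
  exact ⟨h0, h1, h2⟩

lemma FD.aP_eval (D : FD K) (α β γ : ℤ) : aeval D.τ (aP α β γ) = D.E ⟨α,β,γ,0,0,0⟩ := by
  simp [aP, FD.E]

lemma FD.A_eq (D : FD K) : D.τ^3 - D.τ^2 + 1 = -2*D.I*(D.τ^2 - D.τ + 1) := by
  linear_combination D.hτ

lemma FD.fZ_eval (D : FD K) : aeval D.τ fZ = 0 := by
  simp only [fZ, map_add, map_sub, map_mul, map_pow, aeval_X, map_ofNat]
  linear_combination ((D.τ^3 - D.τ^2 + 1) - 2*D.I*(D.τ^2 - D.τ + 1))*D.A_eq + 4*(D.τ^2 - D.τ + 1)^2*D.hI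

lemma FD.B_unit (D : FD K) : (D.τ^2 - D.τ + 1) * (1 - D.τ^2 - 2*D.I*D.τ) = 1 := by
  linear_combination -D.τ*D.A_eq

lemma sq_decomp {R : Type*} [CommRing R] [IsDomain R] [WfDvdMonoid R] (x : R) (hx : x ≠ 0) : ∃ s d : R, x = s^2 * d ∧ Squarefree d := by
  induction x using (wellFounded_dvdNotUnit (α := R)).induction with
  | _ x ih =>
    by_cases hs : Squarefree x
    · exact ⟨1, x, by simp, hs⟩
    · unfold Squarefree at hs
      push Not at hs
      obtain ⟨q, ⟨y, hy⟩, hq⟩ := hs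
      have hy0 : y ≠ 0 := by rintro rfl; simp at hy; exact hx hy
      obtain ⟨s, d, h1, h2⟩ := ih y ⟨hy0, q*q, by rwa [isUnit_mul_self_iff], by rw [hy]; ring⟩ hy0
      exact ⟨q*s, d, by rw [hy, h1]; ring, h2⟩

lemma odd_sq {R : Type*} [CommRing R] [IsDomain R] (π y k : R) (hπ : Prime π) (hy : ¬ π ∣ y) (hk : ¬ π ∣ k) :
    ∀ (j : ℕ) (b : R), b^2 + π^(2*j+1)*y*k = 0 → False := by
  intro j
  induction j with
  | zero =>
    intro b h
    have : π ∣ b := hπ.dvd_of_dvd_pow (n := 2) ⟨-(y*k), by linear_combination h⟩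
    obtain ⟨b', rfl⟩ := this
    have h2 : π * b'^2 + y*k = 0 := by
      apply (mul_eq_zero.1 (show π * (π * b'^2 + y*k) = 0 by linear_combination h)).resolve_left hπ.ne_zero
    rcases hπ.dvd_or_dvd (show π ∣ y * k from ⟨-b'^2, by linear_combination h2⟩) with h | h
    · exact hy h
    · exact hk h
  | succ j ih =>
    intro b h
    have : π ∣ b := hπ.dvd_of_dvd_pow (n := 2) ⟨-(π^(2*j+2)*y*k), by rw [show 2*(j+1)+1 = 2*j+2+1 by ring, pow_succ] at h; linear_combination h⟩
    obtain ⟨b', rfl⟩ := this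
    refine ih b' ?_
    apply (mul_eq_zero.1 (show π^2 * (b'^2 + π^(2*j+1)*y*k) = 0 by rw [show 2*(j+1)+1 = 2*j+1+2 by ring, pow_add] at h; linear_combination h)).resolve_left (pow_ne_zero 2 hπ.ne_zero)

lemma FD.not_odd_aux (D : FD K) {α β γ : ℤ} (hD : Data α β γ) (π y : 𝓞 K) (j : ℕ) (hπ : Prime π) (hy : ¬ π ∣ y)
    (h2 : ¬ π ∣ 2) (ha : D.E ⟨α,β,γ,0,0,0⟩ = π^(2*j+1)*y) {F : Type} [CommRing F] [IsDomain F] (θ : 𝓞 K →+* F)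
    (hmem : ∀ x, θ x = 0 ↔ π ∣ x) (N : ℕ) (hN0 : N ≠ 0) (hN : π ∣ (N : 𝓞 K)) : False := by
  obtain ⟨c, b, k, hc, -, -, h⟩ := hD.ex
  obtain ⟨p, hp⟩ : ∃ p, CharP F p := CharP.exists _
  have hpp : p.Prime := by
    rcases CharP.char_is_prime_or_zero F p with h | h
    · exact h
    · exfalso
      subst h
      have h1 : (N : F) = 0 := by
        have := (hmem _).2 hN
        simpa using this
      have := (CharP.cast_eq_zero_iff F 0 _).1 h1
      simp at this
      exact hN0 this
  have : Fact p.Prime := ⟨hpp⟩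
  obtain ⟨t, ht⟩ : ∃ t : F, t = θ D.τ := ⟨_, rfl⟩
  have hev : ∀ q : ℤ[X], aeval t q = 0 ↔ π ∣ aeval D.τ q := by
    intro q
    rw [← hmem]
    have := Polynomial.aeval_algHom_apply θ.toIntAlgHom D.τ q
    change aeval (θ D.τ) q = θ (aeval D.τ q) at this
    rw [ht, this]
  have hp2 : p ≠ 2 := by
    rintro rfl
    apply h2
    rw [← hmem]
    have := CharP.cast_eq_zero F 2
    rw [map_ofNat]
    exact_mod_cast this
  have ha' : aeval t (aP α β γ) = 0 := by
    rw [hev, D.aP_eval, ha, pow_succ]; exact ⟨π^(2*j)*y, by ring⟩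
  refine descent p t hp2 ((hev _).2 (by rw [D.fZ_eval]; exact dvd_zero _)) (aP α β γ) (aP_natDegree _ _ _) ?_ ha' ?_ c.natAbs c b k (by rintro rfl; simp at hc) le_rfl h
  · intro h
    obtain ⟨h1, h2, h3⟩ := aP_dvd _ _ _ _ h
    have := hD.cop _ h1 h2 h3
    exact (Nat.prime_iff_prime_int.1 hpp).not_isUnit this
  · intro c b k h
    have h1 := congrArg (aeval D.τ) h
    rw [map_add, map_mul, map_mul, D.fZ_eval, D.aP_eval, ha, map_pow, map_pow] at h1
    constructor
    · rw [hev]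
      apply hπ.dvd_of_dvd_pow (n := 2)
      exact ⟨-π^(2*j)*y*aeval D.τ k, by linear_combination -h1⟩
    · rw [hev]
      by_contra hk
      exact odd_sq π y _ hπ hy hk j (aeval D.τ b) (by linear_combination -h1)

lemma FD.not_odd (D : FD K) {α β γ : ℤ} (hD : Data α β γ) (π y : 𝓞 K) (j : ℕ) (hπ : Prime π) (hy : ¬ π ∣ y)
    (h2 : ¬ π ∣ 2) (ha : D.E ⟨α,β,γ,0,0,0⟩ = π^(2*j+1)*y) : False := by
  have hIp : (Ideal.span {π}).IsPrime := (Ideal.span_singleton_prime hπ.ne_zero).2 hπ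
  refine D.not_odd_aux hD π y j hπ hy h2 ha (Ideal.Quotient.mk (Ideal.span {π})) ?_ (Ideal.absNorm (Ideal.span {π})) ?_ ?_
  · intro x; rw [Ideal.Quotient.eq_zero_iff_mem, Ideal.mem_span_singleton]
  · rw [Ne, Ideal.absNorm_eq_zero_iff]; simpa using hπ.ne_zero
  · rw [← Ideal.mem_span_singleton]; exact Ideal.absNorm_mem _

lemma int_cop (π : 𝓞 K) (hπ : Prime π) (h2 : π ∣ 2) (n : ℤ) (hn : n % 2 = 1) (hd : π ∣ (n : 𝓞 K)) : False := by
  apply hπ.not_isUnit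
  apply isUnit_of_dvd_one
  have : (1 : 𝓞 K) = n - 2 * ((n/2 : ℤ) : 𝓞 K) := by
    have : (1:ℤ) = n - 2 * (n/2) := by omega
    exact_mod_cast congrArg (Int.cast : ℤ → 𝓞 K) this
  rw [this]
  exact dvd_sub hd (h2.mul_right _)

theorem FD.sel0 (D : FD K) {α β γ : ℤ} (hD : Data α β γ)
    (ht : α % 2 = 1 ∧ ((β % 2 = 0 ∧ γ % 2 = 0) ∨ (β % 2 = 1 ∧ γ % 2 = 1))) :
    ∃ (u : (𝓞 K)ˣ) (s : 𝓞 K), D.E ⟨α,β,γ,0,0,0⟩ = u * s^2 := by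
  have := D.pid
  have h2 : ∀ π : 𝓞 K, Prime π → π ∣ D.E ⟨α,β,γ,0,0,0⟩ → ¬ π ∣ 2 := by
    intro π hπ hd h2
    obtain ⟨h0, ⟨h1, h2'⟩ | ⟨h1, h2'⟩⟩ := ht
    · obtain ⟨b, rfl⟩ : ∃ b, β = 2 * b := ⟨β/2, by omega⟩
      obtain ⟨c, rfl⟩ : ∃ c, γ = 2 * c := ⟨γ/2, by omega⟩
      apply int_cop π hπ h2 α h0
      have : (α : 𝓞 K) = D.E ⟨α,2*b,2*c,0,0,0⟩ - 2 * (b*D.τ + c*D.τ^2) := by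
        simp [FD.E]; ring
      rw [this]
      exact dvd_sub hd (h2.mul_right _)
    · obtain ⟨a, rfl⟩ : ∃ b, α = 1 + 2 * b := ⟨α/2, by omega⟩
      obtain ⟨b, rfl⟩ : ∃ b, β = -1 + 2 * b := ⟨(β+1)/2, by omega⟩
      obtain ⟨c, rfl⟩ : ∃ c, γ = 1 + 2 * c := ⟨γ/2, by omega⟩
      apply hπ.not_isUnit
      apply isUnit_of_dvd_one
      rw [← D.B_unit]
      apply Dvd.dvd.mul_right
      have : D.τ^2 - D.τ + 1 = D.E ⟨1+2*a,-1+2*b,1+2*c,0,0,0⟩ - 2 * (a + b*D.τ + c*D.τ^2) := by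
        simp [FD.E]; ring
      rw [this]
      exact dvd_sub hd (h2.mul_right _)
  have hne : D.E ⟨α,β,γ,0,0,0⟩ ≠ 0 := by
    intro h
    have : D.E ⟨α,β,γ,0,0,0⟩ = D.E ⟨0,0,0,0,0,0⟩ := by rw [h]; simp [FD.E]
    have := congrArg V6.a0 (D.E_inj this)
    simp only at this
    omega
  obtain ⟨s, d, hsd, hd⟩ := sq_decomp _ hne
  have hu : IsUnit d := by
    by_contra hnu
    have hd0 : d ≠ 0 := hd.ne_zero
    obtain ⟨π, hπ, d', rfl⟩ := WfDvdMonoid.exists_irreducible_factor hnu hd0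
    have hπ' : Prime π := hπ.prime
    have hs0 : s ≠ 0 := by rintro rfl; simp at hsd; exact hne hsd
    obtain ⟨j, s', hs', hs⟩ := WfDvdMonoid.max_power_factor hs0 hπ
    refine D.not_odd hD π (s'^2*d') j hπ' ?_ (h2 π hπ' ⟨s^2*d', by rw [hsd]; ring⟩) (by rw [hsd, hs]; ring)
    intro h
    rcases hπ'.dvd_or_dvd h with h | h
    · exact hs' (hπ'.dvd_of_dvd_pow h)
    · obtain ⟨e, rfl⟩ := h
      exact hπ.not_isUnit (hd π ⟨e, by ring⟩)
  obtain ⟨u, rfl⟩ := hu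
  exact ⟨u, s, by rw [hsd]; ring⟩

lemma sq_mod4 (c x : ℤ) (hc : c % 2 = 1) : (c^2*x) % 4 = x % 4 := by
  obtain ⟨m, rfl⟩ : ∃ m, c = 2*m+1 := ⟨c/2, by omega⟩
  have : (2*m+1)^2*x = x + 4*((m^2+m)*x) := by ring
  rw [this]; omega

theorem FD.sel1 (D : FD K) {α β γ : ℤ} (hD : Data α β γ)
    (ht : α % 2 = 1 ∧ ((β % 2 = 0 ∧ γ % 2 = 0) ∨ (β % 2 = 1 ∧ γ % 2 = 1))) :
    ∃ (n : ℤ) (a b c : Bool) (S : V6), n % 2 = 1 ∧ cm (uV a b c) (cm S S) = ⟨n^2*α,n^2*β,n^2*γ,0,0,0⟩ := by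
  obtain ⟨u, s, h⟩ := D.sel0 hD ht
  obtain ⟨a, b, c, r, hu⟩ := D.units u
  obtain ⟨n, S, hn, hS⟩ := D.odd_index (r*s)
  refine ⟨n, a, b, c, S, hn, D.E_inj ?_⟩
  rw [D.E_mul, D.E_mul, ← D.U_coe, ← hS]
  have h3 : D.E ⟨n^2*α,n^2*β,n^2*γ,0,0,0⟩ = n^2 * D.E ⟨α,β,γ,0,0,0⟩ := by
    simp [FD.E]; ring
  rw [h3, h, hu]
  push_cast
  ring

lemma cm_one (z : V6) : cm (uV false false false) z = z := by
  have : uV false false false = ⟨1,0,0,0,0,0⟩ := by decide +kernel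
  rw [this]
  ext <;> simp [cm]

theorem FD.selI (D : FD K) {α β γ : ℤ} (hD : Data α β γ) (h0 : α % 2 = 1) (h1 : β % 2 = 0) (h2 : γ % 2 = 0) :
    β % 4 = 0 ∧ γ % 4 = 0 ∧
    ∃ (n : ℤ) (S : V6), n % 2 = 1 ∧ cm S S = ⟨n^2*α,n^2*β,n^2*γ,0,0,0⟩ ∧ (α % 4 = 3 → md 2 S = ⟨0,0,0,1,0,0⟩) := by
  obtain ⟨n, a, b, c, S, hn, h⟩ := D.sel1 hD ⟨h0, Or.inl ⟨h1, h2⟩⟩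
  have e0 := sq_mod4 n α hn
  have e1 := sq_mod4 n β hn
  have e2 := sq_mod4 n γ hn
  have hm := (mod4 a b c S).1
  rw [h] at hm
  have := hm ⟨by simp only; omega, by simp only; omega, by simp only; omega, rfl, rfl, rfl⟩
  obtain ⟨rfl, rfl, rfl, h5⟩ := this
  rw [cm_one] at h
  simp only at h5
  refine ⟨by omega, by omega, n, S, hn, h, ?_⟩
  intro h6
  rcases h5 with h5 | h5
  · exact h5.2.2.2
  · omega

theorem FD.selII (D : FD K) {α β γ : ℤ} (hD : Data α β γ) (h0 : α % 2 = 1) (h1 : β % 2 = 1) (h2 : γ % 2 = 1) :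
    ∃ (n : ℤ) (S : V6), n % 2 = 1 ∧ cm S S = ⟨n^2*α,n^2*β,n^2*γ,0,0,0⟩ ∧ (γ % 4 = 3 → md 2 S = ⟨1,1,0,1,1,1⟩) := by
  obtain ⟨n, a, b, c, S, hn, h⟩ := D.sel1 hD ⟨h0, Or.inr ⟨h1, h2⟩⟩
  have e0 := sq_mod4 n α hn
  have e1 := sq_mod4 n β hn
  have e2 := sq_mod4 n γ hn
  have hm := (mod4 a b c S).2
  rw [h] at hm
  have := hm ⟨by simp only; omega, by simp only; omega, by simp only; omega, rfl, rfl, rfl⟩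
  obtain ⟨rfl, rfl, rfl, h5⟩ := this
  rw [cm_one] at h
  simp only at h5
  refine ⟨n, S, hn, h, ?_⟩
  intro h6
  rcases h5 with h5 | h5
  · exact h5.2.2.2
  · omega
end C9

namespace C9
open Polynomial NumberField Module
open V6
variable {K : Type} [Field K] [NumberField K]

def fv (x : ℤ) : ℤ := x ^ 6 - 2 * x ^ 5 + 5 * x ^ 4 - 6 * x ^ 3 + 10 * x ^ 2 - 8 * x + 5

lemma fZ_ev (x : ℤ) : fZ.eval x = fv x := by simp [fZ, fv]

lemma poly6 (c0 c1 c2 c3 c4 c5 c6 : ℤ) (h : ∀ x : ℤ, c0 + c1*x + c2*x^2 + c3*x^3 + c4*x^4 + c5*x^5 + c6*x^6 = 0) :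
    c0 = 0 ∧ c1 = 0 ∧ c2 = 0 ∧ c3 = 0 ∧ c4 = 0 ∧ c5 = 0 ∧ c6 = 0 := by
  have h0 := h 0
  have h1 := h 1
  have h2 := h (-1)
  have h3 := h 2
  have h4 := h (-2)
  have h5 := h 3
  have h6 := h (-3)
  norm_num at h0 h1 h2 h3 h4 h5 h6
  omega

lemma ev3 (b : ℤ[X]) (h : b.natDegree ≤ 3) (x : ℤ) : b.eval x = b.coeff 0 + b.coeff 1 * x + b.coeff 2 * x^2 + b.coeff 3 * x^3 := by
  rw [eval_eq_sum_range' (n := 4) (by omega)]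
  simp [Finset.sum_range_succ]

lemma ev4 (b : ℤ[X]) (h : b.natDegree ≤ 4) (x : ℤ) : b.eval x = b.coeff 0 + b.coeff 1 * x + b.coeff 2 * x^2 + b.coeff 3 * x^3 + b.coeff 4 * x^4 := by
  rw [eval_eq_sum_range' (n := 5) (by omega)]
  simp [Finset.sum_range_succ]

lemma aP_ev (α β γ x : ℤ) : (aP α β γ).eval x = α + β*x + γ*x^2 := by simp [aP]

lemma Data.rel {α β γ : ℤ} (h : Data α β γ) : ∃ c b0 b1 b2 b3 k0 k1 k2 k3 k4 : ℤ, c % 2 = 1 ∧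
    ∀ x : ℤ, c^2 * fv x = (b0 + b1*x + b2*x^2 + b3*x^3)^2 + (α + β*x + γ*x^2)*(k0 + k1*x + k2*x^2 + k3*x^3 + k4*x^4) := by
  obtain ⟨c, b, k, hc, hb, hk, h⟩ := h.ex
  refine ⟨c, b.coeff 0, b.coeff 1, b.coeff 2, b.coeff 3, k.coeff 0, k.coeff 1, k.coeff 2, k.coeff 3, k.coeff 4, hc, fun x => ?_⟩
  have := congrArg (eval x) h
  rw [eval_mul, eval_add, eval_mul, eval_pow, eval_pow, eval_C, fZ_ev, aP_ev, ev3 b hb, ev4 k hk] at this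
  exact this

lemma Data.of {α β γ : ℤ} (hcop : ∀ d : ℤ, d ∣ α → d ∣ β → d ∣ γ → IsUnit d) (c b0 b1 b2 b3 k0 k1 k2 k3 k4 : ℤ) (hc : c % 2 = 1)
    (h : ∀ x : ℤ, c^2 * fv x = (b0 + b1*x + b2*x^2 + b3*x^3)^2 + (α + β*x + γ*x^2)*(k0 + k1*x + k2*x^2 + k3*x^3 + k4*x^4)) :
    Data α β γ := by
  refine ⟨hcop, c, C b0 + C b1 * X + C b2 * X^2 + C b3 * X^3, C k0 + C k1 * X + C k2 * X^2 + C k3 * X^3 + C k4*X^4, hc, ?_, ?_, ?_⟩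
  · compute_degree
  · compute_degree
  · apply Polynomial.funext
    intro x
    rw [eval_mul, eval_add, eval_mul, eval_pow, eval_pow, eval_C, fZ_ev, aP_ev, h x]
    simp

lemma Data.neg {α β γ : ℤ} (h : Data α β γ) : Data (-α) (-β) (-γ) := by
  obtain ⟨c, b0, b1, b2, b3, k0, k1, k2, k3, k4, hc, hr⟩ := h.rel
  refine Data.of ?_ c b0 b1 b2 b3 (-k0) (-k1) (-k2) (-k3) (-k4) hc (fun x => by rw [hr x]; ring)
  intro d h1 h2 h3
  exact h.cop d (by simpa using h1) (by simpa using h2) (by simpa using h3)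

/-- the reversed reduction -/
lemma redu (α β γ N p0 p1 p2 p3 b0 b1 b2 b3 k0 k1 k2 k3 k4 : ℤ) (hα : α ≠ 0)
   (h : ∀ x : ℤ, (p0 + p1*x + p2*x^2 + p3*x^3)^2 - N * (b0 + b1*x + b2*x^2 + b3*x^3)^2 =
       (α + β*x + γ*x^2)*(k0 + k1*x + k2*x^2 + k3*x^3 + k4*x^4)) (L0 L1 M0 M1 : ℤ)
   (hL0 : L0 = (β^2-α*γ)*p0 - α*β*p1 + α^2*p2) (hL1 : L1 = β*γ*p0 - α*γ*p1 + α^2*p3)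
   (hM0 : M0 = (β^2-α*γ)*b0 - α*β*b1 + α^2*b2) (hM1 : M1 = β*γ*b0 - α*γ*b1 + α^2*b3) :
   ∃ e, L0^2 - N*M0^2 = e*α ∧ 2*(L0*L1 - N*M0*M1) = e*β ∧ L1^2 - N*M1^2 = e*γ := by
  obtain ⟨E0, E1, E2, E3, E4, E5, E6⟩ := poly6 (p0^2 - N*b0^2 - α*k0) (2*p0*p1 - N*(2*b0*b1) - (α*k1+β*k0))
     (2*p0*p2+p1^2 - N*(2*b0*b2+b1^2) - (α*k2+β*k1+γ*k0)) (2*p0*p3+2*p1*p2 - N*(2*b0*b3+2*b1*b2) - (α*k3+β*k2+γ*k1))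
     (2*p1*p3+p2^2 - N*(2*b1*b3+b2^2) - (α*k4+β*k3+γ*k2)) (2*p2*p3 - N*(2*b2*b3) - (β*k4+γ*k3))
     (p3^2 - N*b3^2 - γ*k4) (fun x => by linear_combination h x)
  have Q : ∀ s0 s1 L0 L1 : ℤ, ∃ q : ℤ × ℤ × ℤ × ℤ × ℤ, q = (α*s0^2, 2*α*s0*s1 + β*s0^2, 2*L0*s0 + α*s1^2 + 2*β*s0*s1+γ*s0^2,
      2*L0*s1+2*L1*s0+β*s1^2+2*γ*s0*s1, 2*L1*s1+γ*s1^2) := fun s0 s1 L0 L1 => ⟨_, rfl⟩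
  obtain ⟨⟨P0,P1,P2,P3,P4⟩, hP⟩ := Q (α*p0) (α*p1 - β*p0) L0 L1
  obtain ⟨⟨R0,R1,R2,R3,R4⟩, hR⟩ := Q (α*b0) (α*b1 - β*b0) M0 M1
  simp only [Prod.mk.injEq] at hP hR
  obtain ⟨hP0, hP1, hP2, hP3, hP4⟩ := hP
  obtain ⟨hR0, hR1, hR2, hR3, hR4⟩ := hR
  have q0 : α^4*k0 - P0 + N*R0 = 0 := by
    apply (mul_eq_zero.1 (show α * (α^4*k0 - P0 + N*R0) = 0 by subst hP0 hR0; linear_combination -α^4*E0)).resolve_left hα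
  have q1 : α^4*k1 - P1 + N*R1 = 0 := by
    apply (mul_eq_zero.1 (show α * (α^4*k1 - P1 + N*R1) = 0 by
      subst hP0 hR0 hP1 hR1; linear_combination -α^4*E1 - β*q0)).resolve_left hα
  have q2 : α^4*k2 - P2 + N*R2 = 0 := by
    apply (mul_eq_zero.1 (show α * (α^4*k2 - P2 + N*R2) = 0 by
      subst hP0 hR0 hP1 hR1 hP2 hR2 hL0 hM0; linear_combination -α^4*E2 - β*q1 - γ*q0)).resolve_left hα
  have q3 : α^4*k3 - P3 + N*R3 = 0 := by
    apply (mul_eq_zero.1 (show α * (α^4*k3 - P3 + N*R3) = 0 by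
      subst hP0 hR0 hP1 hR1 hP2 hR2 hP3 hR3 hL0 hM0 hL1 hM1; linear_combination -α^4*E3 - β*q2 - γ*q1)).resolve_left hα
  refine ⟨α^4*k4 - P4 + N*R4, ?_, ?_, ?_⟩
  · subst hP0 hR0 hP1 hR1 hP2 hR2 hP3 hR3 hP4 hR4 hL0 hM0 hL1 hM1; linear_combination α^4*E4 + β*q3 + γ*q2
  · subst hP0 hR0 hP1 hR1 hP2 hR2 hP3 hR3 hP4 hR4 hL0 hM0 hL1 hM1; linear_combination α^4*E5 + γ*q3
  · subst hP0 hR0 hP1 hR1 hP2 hR2 hP3 hR3 hP4 hR4 hL0 hM0 hL1 hM1; linear_combination α^4*E6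

/-- consequences; here the linear forms are `L0 t + L1`, root of `α t² + β t + γ`. -/
lemma redu2 (α β γ N L0 L1 M0 M1 e : ℤ) (hα : α ≠ 0) (h0 : L0^2 - N*M0^2 = e*α) (h1 : 2*(L0*L1 - N*M0*M1) = e*β)
    (h2 : L1^2 - N*M1^2 = e*γ) (n c d : ℤ) (hn : n = α*M1^2 - β*M1*M0 + γ*M0^2) (hc : c = α*L1*M1 - β*L1*M0 + γ*L0*M0)
    (hd : d = L0*M1 - L1*M0) : d * (2*c - β*d) = 0 ∧ N*n^2 = c^2 - α*γ*d^2 := by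
  obtain ⟨m0, hm0⟩ : ∃ m0, m0 = (α*M1-β*M0)^2 - γ*α*M0^2 := ⟨_, rfl⟩
  obtain ⟨m1, hm1⟩ : ∃ m1, m1 = -2*(α*M1-β*M0)*α*M0 - β*α*M0^2 := ⟨_, rfl⟩
  constructor
  · have : α^3 ≠ 0 := pow_ne_zero 3 hα
    apply (mul_eq_zero.1 (show α^3 * (d * (2*c - β*d)) = 0 from ?_)).resolve_left this
    subst hm0 hm1 hn hc hd
    linear_combination α^2*((-2*(α*M1-β*M0)*α*M0 - β*α*M0^2))*h2 + (α^2*((α*M1-β*M0)^2 - γ*α*M0^2) - α*β*(-2*(α*M1-β*M0)*α*M0 - β*α*M0^2))*h1 + (-α*β*((α*M1-β*M0)^2 - γ*α*M0^2) + (β^2-α*γ)*(-2*(α*M1-β*M0)*α*M0 - β*α*M0^2))*h0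
  · have : α^2 ≠ 0 := pow_ne_zero 2 hα
    apply mul_left_cancel₀ this
    subst hm0 hm1 hn hc hd
    linear_combination -α^2*((α*M1-β*M0)^2 - γ*α*M0^2)*h2 + α*γ*(-2*(α*M1-β*M0)*α*M0 - β*α*M0^2)*h1 - (-α*γ*((α*M1-β*M0)^2 - γ*α*M0^2) + β*γ*(-2*(α*M1-β*M0)*α*M0 - β*α*M0^2))*h0

lemma is_sq (N n c : ℤ) (hn : n ≠ 0) (h : N*n^2 = c^2) : ∃ m, N = m^2 := by
  have : n ∣ c := (Int.pow_dvd_pow_iff two_ne_zero).1 ⟨N, by linear_combination -h⟩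
  obtain ⟨m, rfl⟩ := this
  exact ⟨m, mul_right_cancel₀ (pow_ne_zero 2 hn) (by linear_combination h)⟩

lemma odd_mul {a b : ℤ} (ha : a % 2 = 1) (hb : b % 2 = 1) : (a*b) % 2 = 1 := by
  rw [Int.mul_emod, ha, hb]; rfl

lemma ev_mul {a b : ℤ} (ha : a % 2 = 0) : (a*b) % 2 = 0 := by
  rw [Int.mul_emod, ha]; simp

lemma sq_par (a : ℤ) : (a^2) % 2 = a % 2 := by
  rcases Int.emod_two_eq_zero_or_one a with h | h <;> rw [sq, Int.mul_emod, h] <;> rfl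

/-- square lemma, type I -/
lemma sqI (α β γ N c p0 p1 p2 p3 b0 b1 b2 b3 k0 k1 k2 k3 k4 c1 : ℤ) (hα : α % 2 = 1) (hβ : β % 4 = 0) (hγ : γ % 2 = 0)
   (h : ∀ x : ℤ, (c*p0 + c*p1*x + c*p2*x^2 + c*p3*x^3)^2 - N * (b0 + b1*x + b2*x^2 + b3*x^3)^2 =
       (α + β*x + γ*x^2)*(k0 + k1*x + k2*x^2 + k3*x^3 + k4*x^4)) (hc : c % 2 = 1) (hp3 : p3 % 2 = 1) (hb3 : b3 % 2 = 1) :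
   ∃ m, N = m^2 := by
  have hα0 : α ≠ 0 := by rintro rfl; simp at hα
  obtain ⟨L0, hL0⟩ : ∃ L, L = (β^2-α*γ)*(c*p0) - α*β*(c*p1) + α^2*(c*p2) := ⟨_, rfl⟩
  obtain ⟨L1, hL1⟩ : ∃ L, L = β*γ*(c*p0) - α*γ*(c*p1) + α^2*(c*p3) := ⟨_, rfl⟩
  obtain ⟨M0, hM0⟩ : ∃ L, L = (β^2-α*γ)*b0 - α*β*b1 + α^2*b2 := ⟨_, rfl⟩
  obtain ⟨M1, hM1⟩ : ∃ L, L = β*γ*b0 - α*γ*b1 + α^2*b3 := ⟨_, rfl⟩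
  obtain ⟨e, h0, h1, h2⟩ := redu α β γ N _ _ _ _ b0 b1 b2 b3 k0 k1 k2 k3 k4 hα0 h L0 L1 M0 M1 hL0 hL1 hM0 hM1
  obtain ⟨n, hn⟩ : ∃ n, n = α*M1^2 - β*M1*M0 + γ*M0^2 := ⟨_, rfl⟩
  obtain ⟨C, hC⟩ : ∃ n, n = α*L1*M1 - β*L1*M0 + γ*L0*M0 := ⟨_, rfl⟩
  obtain ⟨d, hd⟩ : ∃ n, n = L0*M1 - L1*M0 := ⟨_, rfl⟩
  obtain ⟨r1, r2⟩ := redu2 α β γ N L0 L1 M0 M1 e hα0 h0 h1 h2 n C d hn hC hd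
  obtain ⟨β', rfl⟩ : ∃ b, β = 4 * b := ⟨β/4, by omega⟩
  obtain ⟨γ', rfl⟩ : ∃ b, γ = 2 * b := ⟨γ/2, by omega⟩
  have hM1o : M1 % 2 = 1 := by
    have e1 : M1 = α^2*b3 + 2 * (4*β'*γ'*b0 - α*γ'*b1) := by rw [hM1]; ring
    have e2 : (α^2*b3) % 2 = 1 := odd_mul (by rw [sq_par]; exact hα) hb3
    omega
  have hL1o : L1 % 2 = 1 := by
    have e1 : L1 = α^2*(c*p3) + 2 * (4*β'*γ'*(c*p0) - α*γ'*(c*p1)) := by rw [hL1]; ring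
    have e2 : (α^2*(c*p3)) % 2 = 1 := odd_mul (by rw [sq_par]; exact hα) (odd_mul hc hp3)
    omega
  have hno : n % 2 = 1 := by
    have e1 : n = α*M1^2 + 2 * (-2*β'*M1*M0 + γ'*M0^2) := by rw [hn]; ring
    have e2 : (α*M1^2) % 2 = 1 := odd_mul hα (by rw [sq_par]; exact hM1o)
    omega
  have hCo : C % 2 = 1 := by
    have e1 : C = α*(L1*M1) + 2 * (-2*β'*L1*M0 + γ'*L0*M0) := by rw [hC]; ring
    have e2 : (α*(L1*M1)) % 2 = 1 := odd_mul hα (odd_mul hL1o hM1o)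
    omega
  have hd0 : d = 0 := by
    rcases mul_eq_zero.1 r1 with h | h
    · exact h
    · exfalso
      rw [mul_assoc] at h
      omega
  rw [hd0] at r2
  exact is_sq N n C (by omega) (by rw [r2]; ring)

lemma odd_sq8 (a : ℤ) (h : a % 2 = 1) : a^2 % 8 = 1 := by
  rcases (by omega : a % 8 = 1 ∨ a % 8 = 3 ∨ a % 8 = 5 ∨ a % 8 = 7) with h | h | h | h <;> rw [sq, Int.mul_emod, h] <;> rfl

lemma no8 (N n d D : ℤ) (hN : N % 8 = 1) (hn : n % 2 = 1) (hD : D % 8 = 5) (h : 4*(N*n^2) = d^2*D) : False := by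
  have h1 : d % 2 = 0 := by
    by_contra hd
    have : (d^2*D) % 2 = 1 := odd_mul (by rw [sq_par]; omega) (by omega)
    omega
  obtain ⟨e, rfl⟩ : ∃ e, d = 2*e := ⟨d/2, by omega⟩
  have h2 : N*n^2 = e^2*D := by linarith
  have h3 : (N*n^2) % 8 = 1 := by rw [Int.mul_emod, hN, odd_sq8 n hn]; rfl
  rcases Int.emod_two_eq_zero_or_one e with he | he
  · have : (e^2*D) % 2 = 0 := ev_mul (by rw [sq_par]; exact he)
    omega
  · have : (e^2*D) % 8 = 5 := by rw [Int.mul_emod, hD, odd_sq8 e he]; rfl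
    omega

/-- square lemma, type II -/
lemma sqII (α β γ N c p0 p1 p2 p3 b0 b1 b2 b3 k0 k1 k2 k3 k4 : ℤ) (hα : α % 2 = 1) (hβ : β % 2 = 1) (hγ : γ % 2 = 1)
   (hN : N % 8 = 1)
   (h : ∀ x : ℤ, (c*p0 + c*p1*x + c*p2*x^2 + c*p3*x^3)^2 - N * (b0 + b1*x + b2*x^2 + b3*x^3)^2 =
       (α + β*x + γ*x^2)*(k0 + k1*x + k2*x^2 + k3*x^3 + k4*x^4))
   (hb : (b0 + b1 + b3) % 2 = 1 ∨ (b1 + b2) % 2 = 1) :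
   ∃ m, N = m^2 := by
  have hα0 : α ≠ 0 := by rintro rfl; simp at hα
  obtain ⟨L0, hL0⟩ : ∃ L, L = (β^2-α*γ)*(c*p0) - α*β*(c*p1) + α^2*(c*p2) := ⟨_, rfl⟩
  obtain ⟨L1, hL1⟩ : ∃ L, L = β*γ*(c*p0) - α*γ*(c*p1) + α^2*(c*p3) := ⟨_, rfl⟩
  obtain ⟨M0, hM0⟩ : ∃ L, L = (β^2-α*γ)*b0 - α*β*b1 + α^2*b2 := ⟨_, rfl⟩
  obtain ⟨M1, hM1⟩ : ∃ L, L = β*γ*b0 - α*γ*b1 + α^2*b3 := ⟨_, rfl⟩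
  obtain ⟨e, h0, h1, h2⟩ := redu α β γ N _ _ _ _ b0 b1 b2 b3 k0 k1 k2 k3 k4 hα0 h L0 L1 M0 M1 hL0 hL1 hM0 hM1
  obtain ⟨n, hn⟩ : ∃ n, n = α*M1^2 - β*M1*M0 + γ*M0^2 := ⟨_, rfl⟩
  obtain ⟨C, hC⟩ : ∃ n, n = α*L1*M1 - β*L1*M0 + γ*L0*M0 := ⟨_, rfl⟩
  obtain ⟨d, hd⟩ : ∃ n, n = L0*M1 - L1*M0 := ⟨_, rfl⟩
  obtain ⟨r1, r2⟩ := redu2 α β γ N L0 L1 M0 M1 e hα0 h0 h1 h2 n C d hn hC hd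
  obtain ⟨α', hα'⟩ : ∃ a, α = 2 * a + 1 := ⟨α/2, by omega⟩
  obtain ⟨β', hβ'⟩ : ∃ a, β = 2 * a + 1 := ⟨β/2, by omega⟩
  obtain ⟨γ', hγ'⟩ : ∃ a, γ = 2 * a + 1 := ⟨γ/2, by omega⟩
  have hM1o : M1 % 2 = (b0 + b1 + b3) % 2 := by
    rw [hM1, hα', hβ', hγ']
    ring_nf
    omega
  have hM0o : M0 % 2 = (b1 + b2) % 2 := by
    rw [hM0, hα', hβ', hγ']
    ring_nf
    omega
  have hno : n % 2 = 1 := by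
    have e1 : n = M1^2 + M1*M0 + M0^2 + 2 * (α'*M1^2 - β'*M1*M0 - M1*M0 + γ'*M0^2) := by rw [hn, hα', hβ', hγ']; ring
    have e2 : (M1^2 + M1*M0 + M0^2) % 2 = 1 := by
      rcases Int.emod_two_eq_zero_or_one M0 with h | h <;> rcases Int.emod_two_eq_zero_or_one M1 with h' | h' <;>
       first | omega | simp [sq, Int.add_emod, Int.mul_emod, h, h']
    omega
  have hd0 : d = 0 := by
    rcases mul_eq_zero.1 r1 with h | h
    · exact h
    · exfalso
      have hD : (β^2 - 4*(α*γ)) % 8 = 5 := by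
        have e1 := odd_sq8 β hβ
        have e2 := odd_mul hα hγ
        omega
      refine no8 N n d _ hN hno hD ?_
      rw [r2]
      linear_combination (2*C + β*d)*h
  rw [hd0] at r2
  exact is_sq N n C (by omega) (by rw [r2]; ring)
end C9

namespace C9
open Polynomial NumberField Module
open V6
variable {K : Type} [Field K] [NumberField K]

lemma FD.halve_rel (D : FD K) (α β γ n : ℤ) (S T : V6) (α' β' γ' : ℤ) (hS : cm S S = ⟨n^2*α,n^2*β,n^2*γ,0,0,0⟩)
    (hT : T = cm ⟨α',β',γ',0,0,0⟩ S) (h1 : T.b1 = -T.b0) (h2 : T.b2 = T.b0) (x : ℤ) :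
    ((2*T.a0 - T.b0) + 2*T.a1*x + (2*T.a2+T.b0)*x^2 + (-T.b0)*x^3)^2 - 4*n^2*(α'+β'*x+γ'*x^2)^2*(α+β*x+γ*x^2)
      = (T.b0^2 - 4*n^2*γ'^2*γ) * fv x := by
  obtain ⟨P, hP⟩ : ∃ P : ℤ[X], P = (C (2*T.a0 - T.b0) + C (2*T.a1)*X + C (2*T.a2+T.b0)*X^2 + C (-T.b0)*X^3)^2
     - C (4*n^2) * (aP α' β' γ')^2 * aP α β γ := ⟨_, rfl⟩
  have hdeg : P.natDegree ≤ 6 := by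
    rw [hP]; unfold aP; compute_degree
  have hev : aeval D.τ P = 0 := by
    have e1 : D.E T = D.E ⟨α',β',γ',0,0,0⟩ * D.E S := by rw [hT, D.E_mul]
    have e2 : D.E S * D.E S = n^2 * D.E ⟨α,β,γ,0,0,0⟩ := by
      rw [← D.E_mul, hS]; simp only [FD.E]; push_cast; ring
    have e3 : aeval D.τ (C (2*T.a0 - T.b0) + C (2*T.a1)*X + C (2*T.a2+T.b0)*X^2 + C (-T.b0)*X^3 : ℤ[X]) = 2 * D.E T := by
      simp only [map_add, map_mul, map_pow, aeval_X, aeval_C, FD.E, h1, h2]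
      simp only [algebraMap_int_eq, eq_intCast]
      push_cast
      linear_combination (-(T.b0 : 𝓞 K))*D.A_eq
    rw [hP, map_sub, map_mul (aeval D.τ), map_mul (aeval D.τ), map_pow (aeval D.τ), map_pow (aeval D.τ), e3, D.aP_eval, D.aP_eval, e1, aeval_C]
    simp only [algebraMap_int_eq, eq_intCast]
    push_cast
    linear_combination 4 * (D.E ⟨α',β',γ',0,0,0⟩)^2 * e2
  obtain ⟨q, hq⟩ := D.hf P hev
  have hq0 : q.natDegree ≤ 0 := by
    by_cases h0 : q = 0
    · simp [h0]
    rw [hq, fZ_monic.natDegree_mul' h0, fZ_natDegree] at hdeg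
    omega
  have hqC := eq_C_of_natDegree_le_zero hq0
  obtain ⟨N, hN⟩ : ∃ N, N = q.coeff 0 := ⟨_, rfl⟩
  rw [← hN] at hqC
  have hx : ∀ x : ℤ, ((2*T.a0 - T.b0) + 2*T.a1*x + (2*T.a2+T.b0)*x^2 + (-T.b0)*x^3)^2 - 4*n^2*(α'+β'*x+γ'*x^2)^2*(α+β*x+γ*x^2)
      = fv x * N := by
    intro x
    have := congrArg (eval x) hq
    rw [hqC, eval_mul, eval_C, fZ_ev, hP, eval_sub, eval_mul, eval_mul, eval_pow, eval_pow, aP_ev, aP_ev] at this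
    simpa using this
  have hN2 : N = T.b0^2 - 4*n^2*γ'^2*γ := by
    obtain ⟨p0, hp0⟩ : ∃ p, p = 2*T.a0 - T.b0 := ⟨_, rfl⟩
    obtain ⟨p1, hp1⟩ : ∃ p, p = 2*T.a1 := ⟨_, rfl⟩
    obtain ⟨p2, hp2⟩ : ∃ p, p = 2*T.a2 + T.b0 := ⟨_, rfl⟩
    obtain ⟨p3, hp3⟩ : ∃ p, p = T.b0 := ⟨_, rfl⟩
    rw [← hp0, ← hp1, ← hp2, ← hp3] at hx
    rw [← hp3]
    have := poly6 (p0^2 - 4*n^2*(α'^2*α) - 5*N) (2*p0*p1 - 4*n^2*(2*α'*β'*α + α'^2*β) + 8*N)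
      (p1^2+2*p0*p2 - 4*n^2*((β'^2+2*α'*γ')*α + 2*α'*β'*β+α'^2*γ) - 10*N)
      (-2*p0*p3 + 2*p1*p2 - 4*n^2*(2*β'*γ'*α + (β'^2+2*α'*γ')*β + 2*α'*β'*γ) + 6*N)
      (p2^2-2*p1*p3 - 4*n^2*(γ'^2*α + 2*β'*γ'*β + (β'^2+2*α'*γ')*γ) - 5*N)
      (-2*p2*p3 - 4*n^2*(γ'^2*β + 2*β'*γ'*γ) + 2*N)
      (p3^2 - 4*n^2*γ'^2*γ - N)
      (fun x => by have := hx x; unfold fv at this; linear_combination this)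
    linear_combination -this.2.2.2.2.2.2
  rw [hx x, hN2]; ring

lemma V6.halfT (S : V6) : ∃ α' β' γ' : ℤ, ∃ T : V6, T = cm ⟨α',β',γ',0,0,0⟩ S ∧ T.b1 = -T.b0 ∧ T.b2 = T.b0 ∧
   (md 2 S = ⟨0,0,0,1,0,0⟩ → α' % 2 = 1 ∧ β' % 2 = 1 ∧ γ' % 2 = 1 ∧ T.b0 % 2 = 1) ∧
   (md 2 S = ⟨1,1,0,1,1,1⟩ → α' % 2 = 1 ∧ β' % 2 = 0 ∧ γ' % 2 = 0 ∧ T.b0 % 2 = 1) := by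
  obtain ⟨r0, hr0⟩ : ∃ r, r = (cm ⟨1,0,0,0,0,0⟩ S).b0 + (cm ⟨1,0,0,0,0,0⟩ S).b1 := ⟨_, rfl⟩
  obtain ⟨r1, hr1⟩ : ∃ r, r = (cm ⟨0,1,0,0,0,0⟩ S).b0 + (cm ⟨0,1,0,0,0,0⟩ S).b1 := ⟨_, rfl⟩
  obtain ⟨r2, hr2⟩ : ∃ r, r = (cm ⟨0,0,1,0,0,0⟩ S).b0 + (cm ⟨0,0,1,0,0,0⟩ S).b1 := ⟨_, rfl⟩
  obtain ⟨s0, hs0⟩ : ∃ r, r = (cm ⟨1,0,0,0,0,0⟩ S).b1 + (cm ⟨1,0,0,0,0,0⟩ S).b2 := ⟨_, rfl⟩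
  obtain ⟨s1, hs1⟩ : ∃ r, r = (cm ⟨0,1,0,0,0,0⟩ S).b1 + (cm ⟨0,1,0,0,0,0⟩ S).b2 := ⟨_, rfl⟩
  obtain ⟨s2, hs2⟩ : ∃ r, r = (cm ⟨0,0,1,0,0,0⟩ S).b1 + (cm ⟨0,0,1,0,0,0⟩ S).b2 := ⟨_, rfl⟩
  simp only [cm] at hr0 hr1 hr2 hs0 hs1 hs2
  ring_nf at hr0 hr1 hr2 hs0 hs1 hs2
  have lin : ∀ u v w : ℤ, (cm ⟨u,v,w,0,0,0⟩ S).b0 + (cm ⟨u,v,w,0,0,0⟩ S).b1 = u*r0 + v*r1 + w*r2 ∧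
     (cm ⟨u,v,w,0,0,0⟩ S).b1 + (cm ⟨u,v,w,0,0,0⟩ S).b2 = u*s0 + v*s1 + w*s2 := by
    intro u v w
    simp only [cm, hr0, hr1, hr2, hs0, hs1, hs2]
    constructor <;> ring
  obtain ⟨u, hu⟩ : ∃ u, u = r1*s2 - r2*s1 := ⟨_, rfl⟩
  obtain ⟨v, hv⟩ : ∃ u, u = r2*s0 - r0*s2 := ⟨_, rfl⟩
  obtain ⟨w, hw⟩ : ∃ u, u = r0*s1 - r1*s0 := ⟨_, rfl⟩
  have l1 := (lin u v w).1
  have l2 := (lin u v w).2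
  have z1 : u*r0 + v*r1 + w*r2 = 0 := by rw [hu, hv, hw]; ring
  have z2 : u*s0 + v*s1 + w*s2 = 0 := by rw [hu, hv, hw]; ring
  have hb0 : (cm ⟨u,v,w,0,0,0⟩ S).b0 % 2 = (u*S.b0 + w*S.b1 + (v+w)*S.b2) % 2 := by
    simp only [cm]; ring_nf; omega
  refine ⟨u, v, w, _, rfl, by omega, by omega, ?_, ?_⟩
  · intro hm
    simp only [md, V6.mk.injEq] at hm
    obtain ⟨m0, m1, m2, m3, m4, m5⟩ := hm
    have a1 : r0 % 2 = 1 := by omega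
    have a2 : r1 % 2 = 1 := by omega
    have a3 : r2 % 2 = 0 := by omega
    have a4 : s0 % 2 = 0 := by omega
    have a5 : s1 % 2 = 1 := by omega
    have a6 : s2 % 2 = 1 := by omega
    have c1 : u % 2 = 1 := by rw [hu, Int.sub_emod, Int.mul_emod, Int.mul_emod r2, a2, a3, a5, a6]; rfl
    have c2 : v % 2 = 1 := by rw [hv, Int.sub_emod, Int.mul_emod, Int.mul_emod r0, a3, a4, a1, a6]; rfl
    have c3 : w % 2 = 1 := by rw [hw, Int.sub_emod, Int.mul_emod, Int.mul_emod r1, a1, a2, a4, a5]; rfl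
    refine ⟨c1, c2, c3, ?_⟩
    rw [hb0, Int.add_emod, Int.add_emod (u*S.b0), Int.mul_emod, Int.mul_emod w, Int.mul_emod (v+w), m3, m4, m5, c1, c3]
    simp
  · intro hm
    simp only [md, V6.mk.injEq] at hm
    obtain ⟨m0, m1, m2, m3, m4, m5⟩ := hm
    have a1 : r0 % 2 = 0 := by omega
    have a2 : r1 % 2 = 0 := by omega
    have a3 : r2 % 2 = 1 := by omega
    have a4 : s0 % 2 = 0 := by omega
    have a5 : s1 % 2 = 1 := by omega
    have a6 : s2 % 2 = 0 := by omega
    have c1 : u % 2 = 1 := by rw [hu, Int.sub_emod, Int.mul_emod, Int.mul_emod r2, a2, a3, a5, a6]; rfl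
    have c2 : v % 2 = 0 := by rw [hv, Int.sub_emod, Int.mul_emod, Int.mul_emod r0, a3, a4, a1, a6]; rfl
    have c3 : w % 2 = 0 := by rw [hw, Int.sub_emod, Int.mul_emod, Int.mul_emod r1, a1, a2, a4, a5]; rfl
    refine ⟨c1, c2, c3, ?_⟩
    rw [hb0, Int.add_emod, Int.add_emod (u*S.b0), Int.mul_emod, Int.mul_emod w, Int.mul_emod (v+w), m3, m4, m5, c1, c3]
    rw [Int.add_emod v, c2, c3]; rfl


/-- The relation between a and its half. -/
structure Rel (α β γ α' β' γ' n m p0 p1 p2 p3 : ℤ) : Prop where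
  hn : n % 2 = 1
  hm : m % 2 = 1
  h0 : p0 % 2 = 1
  h1 : p1 % 2 = 0
  h2 : p2 % 2 = 1
  h3 : p3 % 2 = 1
  eq : ∀ x : ℤ, (p0 + p1*x + p2*x^2 + p3*x^3)^2 - m^2 * fv x = 4*n^2*(α'+β'*x+γ'*x^2)^2*(α+β*x+γ*x^2)

lemma prim (a b c : ℤ) (ha : a ≠ 0) : ∃ g a' b' c' : ℤ, a = g*a' ∧ b = g*b' ∧ c = g*c' ∧
    ∀ d : ℤ, d ∣ a' → d ∣ b' → d ∣ c' → IsUnit d := by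
  obtain ⟨g, hg⟩ : ∃ g : ℤ, g = gcd a (gcd b c) := ⟨_, rfl⟩
  have g1 : g ∣ a := hg ▸ gcd_dvd_left _ _
  have g2 : g ∣ b := hg ▸ (gcd_dvd_right a _).trans (gcd_dvd_left _ _)
  have g3 : g ∣ c := hg ▸ (gcd_dvd_right a _).trans (gcd_dvd_right _ _)
  obtain ⟨a', h1⟩ := g1
  obtain ⟨b', h2⟩ := g2
  obtain ⟨c', h3⟩ := g3
  refine ⟨g, a', b', c', h1, h2, h3, ?_⟩
  intro d d1 d2 d3
  have hd : g*d ∣ g := by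
    conv_rhs => rw [hg]
    refine dvd_gcd ?_ (dvd_gcd ?_ ?_)
    · rw [h1]; exact mul_dvd_mul_left _ d1
    · rw [h2]; exact mul_dvd_mul_left _ d2
    · rw [h3]; exact mul_dvd_mul_left _ d3
  have hg0 : g ≠ 0 := by rintro rfl; simp at h1; exact ha h1
  have : g*d ∣ g*1 := by simpa using hd
  exact isUnit_of_dvd_one ((mul_dvd_mul_iff_left hg0).1 this)

lemma Rel.data {α β γ α' β' γ' n m p0 p1 p2 p3 : ℤ} (h : Rel α β γ α' β' γ' n m p0 p1 p2 p3) (ha : α' % 2 = 1) :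
    ∃ g α'' β'' γ'' : ℤ, g % 2 = 1 ∧ α' = g*α'' ∧ β' = g*β'' ∧ γ' = g*γ'' ∧ Data α'' β'' γ'' := by
  obtain ⟨g, α'', β'', γ'', h1, h2, h3, hc⟩ := prim α' β' γ' (by rintro rfl; simp at ha)
  refine ⟨g, α'', β'', γ'', ?_, h1, h2, h3, ?_⟩
  · by_contra hg
    have : α' % 2 = 0 := by rw [h1]; exact ev_mul (by omega)
    omega
  · refine Data.of hc m p0 p1 p2 p3 (-4*n^2*g^2*(α''*α)) (-4*n^2*g^2*(α''*β+β''*α)) (-4*n^2*g^2*(α''*γ+β''*β+γ''*α))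
      (-4*n^2*g^2*(β''*γ+γ''*β)) (-4*n^2*g^2*(γ''*γ)) h.hm ?_
    intro x
    have := h.eq x
    rw [h1, h2, h3] at this
    linear_combination -this

theorem FD.halveI (D : FD K) {α β γ : ℤ} (hD : Data α β γ) (h0 : α % 4 = 3) (h1 : β % 2 = 0) (h2 : γ % 2 = 0) :
    ∃ α' β' γ' n m p0 p1 p2 p3, α' % 2 = 1 ∧ β' % 2 = 1 ∧ γ' % 2 = 1 ∧ Rel α β γ α' β' γ' n m p0 p1 p2 p3 := by
  obtain ⟨hβ, hγ, n, S, hn, hS, hS2⟩ := D.selI hD (by omega) h1 h2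
  obtain ⟨α', β', γ', T, hT, hT1, hT2, hp, -⟩ := S.halfT
  obtain ⟨ha, hb, hc, hk⟩ := hp (hS2 h0)
  have rel := D.halve_rel α β γ n S T α' β' γ' hS hT hT1 hT2
  obtain ⟨N, hN⟩ : ∃ N, N = T.b0^2 - 4*n^2*γ'^2*γ := ⟨_, rfl⟩
  rw [← hN] at rel
  obtain ⟨c, b0, b1, b2, b3, k0, k1, k2, k3, k4, hc1, hr⟩ := hD.rel
  have hb3 : b3 % 2 = 1 := by
    have := (poly6 (b0^2 + α*k0 - 5*c^2) (2*b0*b1 + α*k1+β*k0 + 8*c^2) (b1^2+2*b0*b2+α*k2+β*k1+γ*k0-10*c^2)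
      (2*b0*b3+2*b1*b2+α*k3+β*k2+γ*k1+6*c^2) (b2^2+2*b1*b3+α*k4+β*k3+γ*k2-5*c^2) (2*b2*b3+β*k4+γ*k3+2*c^2) (b3^2+γ*k4-c^2)
      (fun x => by have := hr x; unfold fv at this; linear_combination -this)).2.2.2.2.2.2
    have e1 := sq_par b3
    have e2 := sq_par c
    have e3 : (γ*k4) % 2 = 0 := ev_mul h2
    omega
  obtain ⟨m, hm⟩ : ∃ m, N = m^2 := by
    refine sqI α β γ N c (2*T.a0 - T.b0) (2*T.a1) (2*T.a2+T.b0) (-T.b0) b0 b1 b2 b3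
      (4*n^2*c^2*(α'^2) + N*k0) (4*n^2*c^2*(2*α'*β') + N*k1) (4*n^2*c^2*(β'^2+2*α'*γ') + N*k2) (4*n^2*c^2*(2*β'*γ') + N*k3)
      (4*n^2*c^2*γ'^2 + N*k4) 0 (by omega) hβ h2 ?_ hc1 (by omega) hb3
    intro x
    linear_combination c^2*(rel x) + N * (hr x)
  refine ⟨α', β', γ', n, m, 2*T.a0 - T.b0, 2*T.a1, 2*T.a2+T.b0, -T.b0, ha, hb, hc, hn, ?_, by omega, by omega, by omega, by omega, ?_⟩
  · have e1 := sq_par m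
    have e2 := sq_par T.b0
    rw [hm] at hN
    have : m^2 = T.b0^2 - 2*(2*n^2*γ'^2*γ) := by rw [hN]; ring
    omega
  · intro x
    rw [← hm]
    linear_combination rel x

lemma b12 (α β γ c b0 b1 b2 b3 k0 k1 k2 k3 k4 : ZMod 2) (h0 : α = 1) (h1 : β = 1) (h2 : γ = 1) (hc : c = 1)
   (E0 : b0^2 + α*k0 - 5*c^2 = 0) (E1 : 2*b0*b1 + α*k1+β*k0 + 8*c^2 = 0) (E2 : b1^2+2*b0*b2+α*k2+β*k1+γ*k0-10*c^2 = 0)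
   (E3 : 2*b0*b3+2*b1*b2+α*k3+β*k2+γ*k1+6*c^2 = 0) (E4 : b2^2+2*b1*b3+α*k4+β*k3+γ*k2-5*c^2 = 0)
   (E5 : 2*b2*b3+β*k4+γ*k3+2*c^2 = 0) (E6 : b3^2+γ*k4-c^2 = 0) : b1 + b2 = 1 := by
  subst h0 h1 h2 hc
  have two : (2 : ZMod 2) = 0 := by decide
  have sq : ∀ b : ZMod 2, b^2 = b := by decide
  linear_combination E2 + E4 - E1 - E5 - sq b1 - sq b2 + (12 - b0*b2 - b1*b3 + b0*b1 + b2*b3 - k2)*two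

theorem FD.halveII (D : FD K) {α β γ : ℤ} (hD : Data α β γ) (h0 : α % 2 = 1) (h1 : β % 2 = 1) (h2 : γ % 4 = 3) :
    ∃ α' β' γ' n m p0 p1 p2 p3, α' % 2 = 1 ∧ β' % 2 = 0 ∧ γ' % 2 = 0 ∧ Rel α β γ α' β' γ' n m p0 p1 p2 p3 := by
  obtain ⟨n, S, hn, hS, hS2⟩ := D.selII hD (by omega) h1 (by omega)
  obtain ⟨α', β', γ', T, hT, hT1, hT2, -, hp⟩ := S.halfT
  obtain ⟨ha, hb, hc, hk⟩ := hp (hS2 h2)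
  have rel := D.halve_rel α β γ n S T α' β' γ' hS hT hT1 hT2
  obtain ⟨N, hN⟩ : ∃ N, N = T.b0^2 - 4*n^2*γ'^2*γ := ⟨_, rfl⟩
  rw [← hN] at rel
  have hN8 : N % 8 = 1 := by
    have e2 := odd_sq8 T.b0 hk
    obtain ⟨t, rfl⟩ : ∃ t, γ' = 2*t := ⟨γ'/2, by omega⟩
    have : N = T.b0^2 - 8*(2*n^2*t^2*γ) := by rw [hN]; ring
    omega
  obtain ⟨c, b0, b1, b2, b3, k0, k1, k2, k3, k4, hc1, hr⟩ := hD.rel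
  have hb3 : (b1 + b2) % 2 = 1 := by
    obtain ⟨E0, E1, E2, E3, E4, E5, E6⟩ := (poly6 (b0^2 + α*k0 - 5*c^2) (2*b0*b1 + α*k1+β*k0 + 8*c^2) (b1^2+2*b0*b2+α*k2+β*k1+γ*k0-10*c^2)
      (2*b0*b3+2*b1*b2+α*k3+β*k2+γ*k1+6*c^2) (b2^2+2*b1*b3+α*k4+β*k3+γ*k2-5*c^2) (2*b2*b3+β*k4+γ*k3+2*c^2) (b3^2+γ*k4-c^2)
      (fun x => by have := hr x; unfold fv at this; linear_combination -this))
    have cast : ∀ z : ℤ, z % 2 = 1 ↔ (z : ZMod 2) = 1 := by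
      intro z
      have := ZMod.intCast_eq_intCast_iff' z 1 2
      simpa using this.symm
    rw [cast]
    push_cast
    refine b12 α β γ c b0 b1 b2 b3 k0 k1 k2 k3 k4 ((cast _).1 h0) ((cast _).1 h1) ((cast _).1 (by omega)) ((cast _).1 hc1) ?_ ?_ ?_ ?_ ?_ ?_ ?_
    · exact_mod_cast congrArg (Int.cast : ℤ → ZMod 2) E0
    · exact_mod_cast congrArg (Int.cast : ℤ → ZMod 2) E1
    · exact_mod_cast congrArg (Int.cast : ℤ → ZMod 2) E2
    · exact_mod_cast congrArg (Int.cast : ℤ → ZMod 2) E3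
    · exact_mod_cast congrArg (Int.cast : ℤ → ZMod 2) E4
    · exact_mod_cast congrArg (Int.cast : ℤ → ZMod 2) E5
    · exact_mod_cast congrArg (Int.cast : ℤ → ZMod 2) E6
  obtain ⟨m, hm⟩ : ∃ m, N = m^2 := by
    refine sqII α β γ N c (2*T.a0 - T.b0) (2*T.a1) (2*T.a2+T.b0) (-T.b0) b0 b1 b2 b3
      (4*n^2*c^2*(α'^2) + N*k0) (4*n^2*c^2*(2*α'*β') + N*k1) (4*n^2*c^2*(β'^2+2*α'*γ') + N*k2) (4*n^2*c^2*(2*β'*γ') + N*k3)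
      (4*n^2*c^2*γ'^2 + N*k4) (by omega) h1 (by omega) hN8 ?_ (Or.inr hb3)
    intro x
    linear_combination c^2*(rel x) + N * (hr x)
  refine ⟨α', β', γ', n, m, 2*T.a0 - T.b0, 2*T.a1, 2*T.a2+T.b0, -T.b0, ha, hb, hc, hn, ?_, by omega, by omega, by omega, by omega, ?_⟩
  · have e1 := sq_par m
    rw [hm] at hN8
    omega
  · intro x
    rw [← hm]
    linear_combination rel x
end C9

namespace C9
open Polynomial NumberField Module
open V6

/-- reduction mod 2 -/
noncomputable def r2 : ℤ[X] →+* (ZMod 2)[X] := mapRingHom (Int.castRingHom (ZMod 2))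

lemma r2_zero (P : ℤ[X]) : r2 P = 0 ↔ C 2 ∣ P := by
  rw [C_dvd_iff_dvd_coeff, Polynomial.ext_iff]
  refine forall_congr' fun i => ?_
  rw [r2, coe_mapRingHom, coeff_map, coeff_zero, eq_intCast]
  exact_mod_cast ZMod.intCast_zmod_eq_zero_iff_dvd (P.coeff i) 2

lemma r2_two (P : ℤ[X]) : r2 (C 2 * P) = 0 := (r2_zero _).2 ⟨P, rfl⟩

lemma r2_odd (z : ℤ) (h : z % 2 = 1) : r2 (C z) = 1 := by
  have : r2 (C z - 1) = 0 := (r2_zero _).2 ⟨C (z/2), by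
    have : z = 2 * (z/2) + 1 := by omega
    conv_lhs => rw [this]
    simp only [map_add, map_mul, map_one]; ring⟩
  rw [map_sub, map_one] at this
  linear_combination this

lemma step_key (q d h F : (ZMod 2)[X]) (hF : F = X^3 + X^2 + 1) (hh : ¬ F ∣ h) (hq : q.natDegree ≤ 2)
    (he : d * F = h * q) : d = 0 ∧ q = 0 := by
  have hFp : Prime F := by rw [hF]; exact cubicF2_irred.prime
  have hd : F.natDegree = 3 := by rw [hF]; compute_degree!
  have hFq : F ∣ q := (hFp.dvd_or_dvd (Dvd.intro_left d he)).resolve_left hh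
  have q0 : q = 0 := by
    by_contra hq0
    have := natDegree_le_of_dvd hFq hq0
    omega
  refine ⟨?_, q0⟩
  rw [q0, mul_zero] at he
  exact (mul_eq_zero.1 he).resolve_right hFp.ne_zero

lemma key_ind (j : ℕ) (δ G U H Q R : ℤ[X]) (h : U*(δ*(G+δ)) = H*Q + C 2^(j+1)*R) (hU : r2 U = 1)
    (hG : r2 G = X^3 + X^2 + 1) (hH : ¬ (X^3 + X^2 + 1) ∣ r2 H) (hQ : Q.natDegree ≤ 2) (hQ2 : C 2 ∣ Q) (hδ : C 2 ∣ δ) :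
    ∀ i, i ≤ j → C 2^(i+1) ∣ δ ∧ C 2^(i+1) ∣ Q := by
  have h2 : (C 2 : ℤ[X]) ≠ 0 := by simp
  intro i
  induction i with
  | zero => intro _; simpa using ⟨hδ, hQ2⟩
  | succ i ih =>
    intro hi
    obtain ⟨⟨d, hd⟩, ⟨q, hq⟩⟩ := ih (by omega)
    obtain ⟨s, rfl⟩ : ∃ s, j = i + 1 + s := ⟨j - (i+1), by omega⟩
    have e : U*(d*(G + C 2 * (C 2 ^ i * d))) = H*q + C 2 * (C 2^s*R) := by
      apply mul_left_cancel₀ (pow_ne_zero (i+1) h2)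
      rw [hd, hq] at h
      linear_combination h
    have e2 := congrArg r2 e
    rw [map_mul, map_mul, map_add, map_add, r2_two, r2_two, map_mul, hU, hG] at e2
    have hqd : q.natDegree ≤ 2 := by
      by_cases hq0 : q = 0
      · simp [hq0]
      have : C (2:ℤ) ^ (i+1) = C (2^(i+1)) := by rw [C_pow]
      rw [hq, this, natDegree_C_mul (pow_ne_zero _ two_ne_zero)] at hQ
      exact hQ
    obtain ⟨k1, k2⟩ := step_key (r2 q) (r2 d) (r2 H) _ rfl hH ((natDegree_map_le).trans hqd) (by linear_combination e2)
    rw [r2_zero] at k1 k2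
    obtain ⟨d', rfl⟩ := k1
    obtain ⟨q', rfl⟩ := k2
    exact ⟨⟨d', by rw [hd]; ring⟩, ⟨q', by rw [hq]; ring⟩⟩

lemma key (j : ℕ) (δ G U H Q R : ℤ[X]) (h : U*(δ*(G+δ)) = H*Q + C 2^(j+1)*R) (hU : r2 U = 1)
    (hG : r2 G = X^3 + X^2 + 1) (hH : ¬ (X^3 + X^2 + 1) ∣ r2 H) (hQ : Q.natDegree ≤ 2) (hQ2 : C 2 ∣ Q) :
    C 2^(j+1) ∣ Q := by
  have e2 := congrArg r2 h
  have t : r2 (C 2^(j+1) * R) = 0 := by rw [pow_succ', mul_assoc, r2_two]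
  rw [map_add, t, map_mul, hU, map_mul, map_mul, (r2_zero Q).2 hQ2, map_add] at e2
  have e3 : r2 δ * (r2 G + r2 δ) = 0 := by linear_combination e2
  rcases mul_eq_zero.1 e3 with h1 | h1
  · exact (key_ind j δ G U H Q R h hU hG hH hQ hQ2 ((r2_zero _).1 h1) j le_rfl).2
  · refine (key_ind j (G+δ) (-G) U H Q R (by rw [← h]; ring) hU ?_ hH hQ hQ2 ((r2_zero _).1 (by rw [map_add, h1])) j le_rfl).2
    rw [map_neg, hG]
    exact CharTwo.neg_eq _

lemma aP_dvd_iff (α β γ d : ℤ) : C d ∣ aP α β γ ↔ d ∣ α ∧ d ∣ β ∧ d ∣ γ := by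
  refine ⟨aP_dvd α β γ d, ?_⟩
  rintro ⟨⟨a, rfl⟩, ⟨b, rfl⟩, ⟨c, rfl⟩⟩
  refine ⟨aP a b c, ?_⟩
  simp only [aP, C_mul]; ring

lemma odd_cancel (j : ℕ) (u z : ℤ) (hu : u % 2 = 1) (h : 2^j ∣ u*z) : 2^j ∣ z := by
  refine IsCoprime.dvd_of_dvd_mul_left ?_ h
  apply IsCoprime.pow_left
  exact ⟨-(u/2), 1, by omega⟩

lemma not_dvd_B : ¬ (X^3 + X^2 + 1 : (ZMod 2)[X]) ∣ (X^2 + X + 1)^2 := by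
  intro h
  have h2 := cubicF2_irred.prime.dvd_of_dvd_pow h
  have hd : (X^3 + X^2 + 1 : (ZMod 2)[X]).natDegree = 3 := by compute_degree!
  have hd2 : (X^2 + X + 1 : (ZMod 2)[X]).natDegree = 2 := by compute_degree!
  have := natDegree_le_of_dvd h2 (by intro h; rw [h] at hd2; simp at hd2)
  omega

lemma r2_X : r2 X = X := by simp [r2]

theorem Rel.valI {α β γ α' β' γ' n m p0 p1 p2 p3 : ℤ} (h : Rel α β γ α' β' γ' n m p0 p1 p2 p3) (i : ℕ)
   (h0 : α % 2 = 1) (h1 : β % 2 = 0) (h2 : γ % 2 = 0) (hγ : γ' % 2 = 1)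
   (d1 : 2^(i+1) ∣ α' - γ') (d2 : 2^(i+1) ∣ β' + γ') : 2^(i+2) ∣ β ∧ 2^(i+2) ∣ γ := by
  have e0 := h.h0
  have e1 := h.h1
  have e2 := h.h2
  have e3 := h.h3
  have hm := h.hm
  have hn := h.hn
  obtain ⟨d0, hd0⟩ : ∃ d, p0 = m + 2*d := ⟨(p0-m)/2, by omega⟩
  obtain ⟨d1', hd1⟩ : ∃ d, p1 = 2*d := ⟨p1/2, by omega⟩
  obtain ⟨d2', hd2⟩ : ∃ d, p2 = -m + 2*d := ⟨(p2+m)/2, by omega⟩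
  obtain ⟨d3, hd3⟩ : ∃ d, p3 = m + 2*d := ⟨(p3-m)/2, by omega⟩
  obtain ⟨u, hu⟩ := d1
  obtain ⟨v, hv⟩ := d2
  have hu' : α' = γ' + 2^(i+1)*u := by linear_combination hu
  have hv' : β' = -γ' + 2^(i+1)*v := by linear_combination hv
  have hw : (γ'^2*n^2) % 2 = 1 := odd_mul (by rw [sq_par]; exact hγ) (by rw [sq_par]; exact hn)
  have main := key (i+1) (C d0 + C d1' * X + C d2' * X^2 + C d3 * X^3) (C m * (X^3 - X^2 + 1)) (C (γ'^2))
    ((aP α' β' γ')^2) (aP (m^2 + γ'^2*n^2*α) (γ'^2*n^2*β) (γ'^2*n^2*γ))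
    (C (m^2) * (-(aP α' β' γ') * (C u + C v * X) + C (2^i) * (C u + C v*X)^2)) ?_ ?_ ?_ ?_ (aP_natDegree _ _ _) ?_
  · rw [← C_pow, aP_dvd_iff] at main
    exact ⟨odd_cancel _ _ _ hw main.2.1, odd_cancel _ _ _ hw main.2.2⟩
  · apply Polynomial.funext
    intro x
    have := h.eq x
    rw [hd0, hd1, hd2, hd3] at this
    unfold fv at this
    simp only [eval_add, eval_mul, eval_sub, eval_pow, eval_C, eval_X, eval_one, eval_neg, aP_ev]
    have t2 : (d0 + d1'*x + d2'*x^2 + d3*x^3) * (m*(x^3-x^2+1) + (d0 + d1'*x + d2'*x^2 + d3*x^3))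
      = m^2*(x^2-x+1)^2 + n^2*(α'+β'*x+γ'*x^2)^2*(α+β*x+γ*x^2) := by linarith
    rw [t2, hu', hv']
    ring
  · exact r2_odd _ (by rw [sq_par]; exact hγ)
  · rw [map_mul, r2_odd m hm, map_add, map_sub, map_pow, map_pow, r2_X, map_one, one_mul, CharTwo.sub_eq_add]
  · have : r2 (aP α' β' γ') = X^2 + X + 1 := by
      have a1 : α' % 2 = 1 := by rw [hu', pow_succ']; rw [mul_assoc]; omega
      have a2 : β' % 2 = 1 := by rw [hv', pow_succ']; rw [mul_assoc]; omega
      rw [aP, map_add, map_add, map_mul, map_mul, r2_odd _ a1, r2_odd _ a2, r2_odd _ hγ, map_pow, r2_X]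
      ring
    rw [map_pow, this]
    exact not_dvd_B
  · rw [aP_dvd_iff]
    refine ⟨?_, ?_, ?_⟩
    · have a1 := odd_mul hw h0
      have a2 := sq_par m
      omega
    · exact Dvd.dvd.mul_left (by omega) _
    · exact Dvd.dvd.mul_left (by omega) _

theorem Rel.valII {α β γ α' β' γ' n m p0 p1 p2 p3 : ℤ} (h : Rel α β γ α' β' γ' n m p0 p1 p2 p3) (i : ℕ)
   (h0 : α % 2 = 1) (h1 : β % 2 = 1) (h2 : γ % 2 = 1) (hα : α' % 2 = 1)
   (d1 : 2^(i+1) ∣ β') (d2 : 2^(i+1) ∣ γ') : 2^(i+2) ∣ α - γ ∧ 2^(i+2) ∣ β + γ := by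
  have e0 := h.h0
  have e1 := h.h1
  have e2 := h.h2
  have e3 := h.h3
  have hm := h.hm
  have hn := h.hn
  obtain ⟨d0, hd0⟩ : ∃ d, p0 = -m + 2*d := ⟨(p0+m)/2, by omega⟩
  obtain ⟨d1', hd1⟩ : ∃ d, p1 = 2*m + 2*d := ⟨p1/2-m, by omega⟩
  obtain ⟨d2', hd2⟩ : ∃ d, p2 = -m + 2*d := ⟨(p2+m)/2, by omega⟩
  obtain ⟨d3, hd3⟩ : ∃ d, p3 = m + 2*d := ⟨(p3-m)/2, by omega⟩
  obtain ⟨u, hu⟩ := d1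
  obtain ⟨v, hv⟩ := d2
  have hw : (n^2*α'^2) % 2 = 1 := odd_mul (by rw [sq_par]; exact hn) (by rw [sq_par]; exact hα)
  have main := key (i+1) (C d0 + C d1' * X + C d2' * X^2 + C d3 * X^3) (C m * (X^3 - X^2 + C 2 * X - 1)) 1
    1 (aP (m^2 + n^2*α'^2*α) (-m^2 + n^2*α'^2*β) (m^2 + n^2*α'^2*γ))
    (C (n^2) * aP α β γ * (C α' * (C u * X + C v * X^2) + C (2^i) * (C u * X + C v*X^2)^2)) ?_ (map_one _) ?_ ?_ (aP_natDegree _ _ _) ?_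
  · rw [← C_pow, aP_dvd_iff] at main
    obtain ⟨m1, m2, m3⟩ := main
    constructor
    · apply odd_cancel _ _ _ hw
      have := dvd_sub m1 m3
      ring_nf at this ⊢
      exact this
    · apply odd_cancel _ _ _ hw
      have := dvd_add m2 m3
      ring_nf at this ⊢
      exact this
  · apply Polynomial.funext
    intro x
    have := h.eq x
    rw [hd0, hd1, hd2, hd3] at this
    unfold fv at this
    simp only [eval_add, eval_mul, eval_sub, eval_pow, eval_C, eval_X, eval_one, aP_ev]
    have t2 : (d0 + d1'*x + d2'*x^2 + d3*x^3) * (m*(x^3-x^2+2*x-1) + (d0 + d1'*x + d2'*x^2 + d3*x^3))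
      = m^2*(x^2-x+1) + n^2*(α'+β'*x+γ'*x^2)^2*(α+β*x+γ*x^2) := by linarith
    rw [t2, hu, hv]
    ring
  · rw [map_mul, r2_odd m hm, map_sub, map_add, map_sub, map_pow, map_pow, r2_two, r2_X, map_one, one_mul, CharTwo.sub_eq_add, CharTwo.sub_eq_add, add_zero]
  · rw [map_one]
    intro h
    exact cubicF2_irred.not_isUnit (isUnit_of_dvd_one h)
  · rw [aP_dvd_iff]
    have a2 := sq_par m
    refine ⟨?_, ?_, ?_⟩
    · have a1 := odd_mul hw h0
      omega
    · have a1 := odd_mul hw h1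
      omega
    · have a1 := odd_mul hw h2
      omega
end C9

namespace C9
open Polynomial NumberField Module
open V6
variable {K : Type} [Field K] [NumberField K]

lemma odd_right {g a b : ℤ} (h : b = g*a) (hb : b % 2 = 1) : a % 2 = 1 := by
  by_contra ha
  have : b % 2 = 0 := by rw [h, mul_comm]; exact ev_mul (by omega)
  omega

lemma ev_right {g a b : ℤ} (h : b = g*a) (hg : g % 2 = 1) (hb : b % 2 = 0) : a % 2 = 0 := by
  by_contra ha
  have : b % 2 = 1 := by rw [h]; exact odd_mul hg (by omega)
  omega

theorem FD.tower (D : FD K) (n : ℕ) :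
    (∀ α β γ : ℤ, Data α β γ → α % 2 = 1 → β % 2 = 0 → γ % 2 = 0 → 2^(n+1) ∣ β ∧ 2^(n+1) ∣ γ) ∧
    (∀ α β γ : ℤ, Data α β γ → α % 2 = 1 → β % 2 = 1 → γ % 2 = 1 → 2^(n+1) ∣ α - γ ∧ 2^(n+1) ∣ β + γ) := by
  induction n with
  | zero =>
    constructor
    · intro α β γ _ h0 h1 h2
      exact ⟨by omega, by omega⟩
    · intro α β γ _ h0 h1 h2
      exact ⟨by omega, by omega⟩
  | succ n ih =>
    obtain ⟨ih1, ih2⟩ := ih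
    have s1 : ∀ α β γ : ℤ, Data α β γ → α % 4 = 3 → β % 2 = 0 → γ % 2 = 0 → 2^(n+2) ∣ β ∧ 2^(n+2) ∣ γ := by
      intro α β γ hD h0 h1 h2
      obtain ⟨α', β', γ', n', m, p0, p1, p2, p3, a0, a1, a2, hR⟩ := D.halveI hD h0 h1 h2
      obtain ⟨g, α'', β'', γ'', hg, g0, g1, g2, hD'⟩ := hR.data a0
      obtain ⟨v1, v2⟩ := ih2 _ _ _ hD' (odd_right g0 a0) (odd_right g1 a1) (odd_right g2 a2)
      refine hR.valI n (by omega) h1 h2 a2 ?_ ?_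
      · rw [g0, g2, ← mul_sub]; exact Dvd.dvd.mul_left v1 _
      · rw [g1, g2, ← mul_add]; exact Dvd.dvd.mul_left v2 _
    have s2 : ∀ α β γ : ℤ, Data α β γ → α % 2 = 1 → β % 2 = 1 → γ % 4 = 3 → 2^(n+2) ∣ α - γ ∧ 2^(n+2) ∣ β + γ := by
      intro α β γ hD h0 h1 h2
      obtain ⟨α', β', γ', n', m, p0, p1, p2, p3, a0, a1, a2, hR⟩ := D.halveII hD h0 h1 h2
      obtain ⟨g, α'', β'', γ'', hg, g0, g1, g2, hD'⟩ := hR.data a0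
      obtain ⟨v1, v2⟩ := ih1 _ _ _ hD' (odd_right g0 a0) (ev_right g1 hg a1) (ev_right g2 hg a2)
      refine hR.valII n h0 h1 (by omega) a0 ?_ ?_
      · rw [g1]; exact Dvd.dvd.mul_left v1 _
      · rw [g2]; exact Dvd.dvd.mul_left v2 _
    constructor
    · intro α β γ hD h0 h1 h2
      rcases (by omega : α % 4 = 3 ∨ (-α) % 4 = 3) with h | h
      · exact s1 _ _ _ hD h h1 h2
      · have := s1 _ _ _ hD.neg h (by omega) (by omega)
        simpa using this
    · intro α β γ hD h0 h1 h2
      rcases (by omega : γ % 4 = 3 ∨ (-γ) % 4 = 3) with h | h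
      · exact s2 _ _ _ hD h0 h1 h
      · obtain ⟨t1, t2⟩ := s2 _ _ _ hD.neg (by omega) (by omega) h
        constructor
        · rw [← dvd_neg, neg_sub]; rwa [neg_sub_neg] at t1
        · rw [← dvd_neg, neg_add]; exact t2

theorem FD.zero (D : FD K) {α β γ : ℤ} (hD : Data α β γ) (h0 : α % 2 = 1) (h1 : β % 2 = 0) (h2 : γ % 2 = 0) : β = 0 := by
  by_contra hb
  have h := ((D.tower β.natAbs).1 α β γ hD h0 h1 h2).1
  have h3 := Int.le_of_dvd (by positivity) ((dvd_abs _ _).2 h)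
  have h4 : β.natAbs + 1 < 2^(β.natAbs+1) := Nat.lt_two_pow_self
  have h5 : ((β.natAbs : ℤ) + 1) < 2^(β.natAbs+1) := by exact_mod_cast h4
  rw [Int.abs_eq_natAbs] at h3
  omega

/-- A point gives data. -/
lemma point_data (X' Z Y : ℤ) (r : ℕ) (Zo : ℤ) (hZ : Z = 2^r * Zo) (hZo : Zo % 2 = 1) (hZ2 : Z % 2 = 0) (hX : X' % 2 = 1)
    (hcop : IsCoprime X' Z) (hY4 : (Y - X'^3) % 4 = 0)
    (h : Y^2 = X'^6 - 2*X'^5*Z + 5*X'^4*Z^2 - 6*X'^3*Z^3 + 10*X'^2*Z^4 - 8*X'*Z^5 + 5*Z^6) : Data X' (-Z) 0 := by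
  have hZ0 : Z ≠ 0 := by
    rw [hZ]; refine mul_ne_zero (pow_ne_zero _ two_ne_zero) ?_
    rintro rfl; simp at hZo
  have hX3 : X'^3 % 2 = 1 := by rw [pow_succ]; exact odd_mul (by rw [sq_par]; exact hX) hX
  have hdiv : 2^r ∣ Y - X'^3 := by
    obtain ⟨w, hw⟩ : ∃ w, Y + X'^3 = 2*w := ⟨(Y+X'^3)/2, by omega⟩
    obtain ⟨z, hz⟩ : ∃ z, Z = 2*z := ⟨Z/2, by omega⟩
    have hwo : w % 2 = 1 := by omega
    apply odd_cancel r w _ hwo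
    refine ⟨Zo*(-X'^5 + 5*X'^4*z - 6*X'^3*Z*z + 10*X'^2*Z^2*z - 8*X'*Z^3*z + 5*Z^4*z), ?_⟩
    have e : 2*(w*(Y - X'^3)) = 2*(Z*(-X'^5 + 5*X'^4*z - 6*X'^3*Z*z + 10*X'^2*Z^2*z - 8*X'*Z^3*z + 5*Z^4*z)) := by
      have : (Y + X'^3)*(Y-X'^3) = Z*(-2*X'^5 + 5*X'^4*(2*z) - 6*X'^3*Z*(2*z) + 10*X'^2*Z^2*(2*z) - 8*X'*Z^3*(2*z) + 5*Z^4*(2*z)) := by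
        rw [← hz]; linear_combination h
      rw [hw] at this
      linear_combination this
    have e2 := mul_left_cancel₀ two_ne_zero e
    rw [e2]
    conv_lhs => rw [hZ]
    conv_rhs => rw [hZ]
    ring
  obtain ⟨b2, hb2⟩ := hdiv
  have hb : b2 * Z = Zo*(Y - X'^3) := by rw [hb2, hZ]; ring
  obtain ⟨k3, hk3⟩ : ∃ k, k = Zo^2*(-6*X'^3+10*Z*X'^2-8*Z^2*X'+5*Z^3) := ⟨_, rfl⟩
  have hcr : X' * (2*(X'^2*Zo)^2 + 2*(X'^2*Zo)*b2) = Z*(5*(X'^2*Zo)^2 - b2^2 + Z*k3) := by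
    apply mul_left_cancel₀ hZ0
    rw [hk3]
    linear_combination (2*X'^3*Zo + b2*Z + Zo*(Y-X'^3))*hb + Zo^2*h
  obtain ⟨k4, hk4⟩ : Z ∣ 2*(X'^2*Zo)^2 + 2*(X'^2*Zo)*b2 :=
    hcop.symm.dvd_of_dvd_mul_left ⟨_, hcr⟩
  have hk4' : X'*k4 = 5*(X'^2*Zo)^2 - b2^2 + Z*k3 := by
    apply mul_left_cancel₀ hZ0
    rw [← hcr, hk4]; ring
  refine Data.of ?_ (X'^2*Zo) 0 0 b2 (X'^2*Zo) (5*X'^3*Zo^2) (Zo^2*(-8*X'^3+5*Z*X'^2)) (Zo^2*(10*X'^3-8*Z*X'^2+5*Z^2*X')) k3 k4 ?_ ?_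
  · intro d d1 d2 _
    exact hcop.isUnit_of_dvd' d1 (by simpa using d2)
  · exact odd_mul (by rw [sq_par]; exact hX) hZo
  · intro x
    unfold fv
    have t3 : X'*k3 = -6*(X'^2*Zo)^2 + Z*(Zo^2*(10*X'^3-8*Z*X'^2+5*Z^2*X')) := by rw [hk3]; ring
    linear_combination -x^4*hk4' - x^3*t3 + x^5 * (-1)*hk4

lemma mod8 (X' Z Y : ZMod 8) (h : Y^2 = X'^6 - 2*X'^5*Z + 5*X'^4*Z^2 - 6*X'^3*Z^3 + 10*X'^2*Z^4 - 8*X'*Z^5 + 5*Z^6) :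
    2 ∣ Z.val := by
  revert X' Z Y
  decide +kernel

theorem FD.no_point (D : FD K) (x y : ℚ) (h : y ^ 2 = x ^ 6 - 2 * x ^ 5 + 5 * x ^ 4 - 6 * x ^ 3 + 10 * x ^ 2 - 8 * x + 5) : False := by
  obtain ⟨X', hX⟩ : ∃ X', X' = x.num := ⟨_, rfl⟩
  obtain ⟨Z, hZ⟩ : ∃ Z : ℤ, Z = x.den := ⟨_, rfl⟩
  have hZ0 : Z ≠ 0 := by rw [hZ]; exact_mod_cast x.den_ne_zero
  have hZq : (Z:ℚ) ≠ 0 := by exact_mod_cast hZ0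
  have hx : x = X' / Z := by rw [hX, hZ]; exact_mod_cast (Rat.num_div_den x).symm
  have hcop : IsCoprime X' Z := by
    rw [hX, hZ, Int.isCoprime_iff_gcd_eq_one]
    exact x.reduced
  have hy : (y*Z^3)^2 = ((X'^6 - 2*X'^5*Z + 5*X'^4*Z^2 - 6*X'^3*Z^3 + 10*X'^2*Z^4 - 8*X'*Z^5 + 5*Z^6 : ℤ) : ℚ) := by
    rw [mul_pow, h, hx]; push_cast; field_simp
  obtain ⟨Y, hY⟩ : ∃ Y : ℤ, (Y:ℚ) = y*Z^3 := by
    have hi : IsIntegral ℤ ((y*Z^3)^2) := by rw [hy]; exact isIntegral_algebraMap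
    have := IsIntegrallyClosed.isIntegral_iff.1 (hi.of_pow (by norm_num : 0 < 2))
    obtain ⟨Y, hY⟩ := this
    exact ⟨Y, by simpa using hY⟩
  have hYZ : Y^2 = X'^6 - 2*X'^5*Z + 5*X'^4*Z^2 - 6*X'^3*Z^3 + 10*X'^2*Z^4 - 8*X'*Z^5 + 5*Z^6 := by
    rw [← hY] at hy; exact_mod_cast hy
  have hZ2 : Z % 2 = 0 := by
    have h8 := mod8 X' Z Y (by exact_mod_cast congrArg (Int.cast : ℤ → ZMod 8) hYZ)
    have h9 := ZMod.val_intCast (n := 8) Z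
    omega
  have hX2 : X' % 2 = 1 := by
    obtain ⟨u, v, huv⟩ := hcop
    by_contra hX2
    have t1 : (u*X') % 2 = 0 := by rw [mul_comm]; exact ev_mul (by omega)
    have t2 : (v*Z) % 2 = 0 := by rw [mul_comm]; exact ev_mul (by omega)
    omega
  have hX3 : X'^3 % 2 = 1 := by rw [pow_succ]; exact odd_mul (by rw [sq_par]; exact hX2) hX2
  have hY2 : Y % 2 = 1 := by
    rw [← sq_par, hYZ]
    obtain ⟨z, rfl⟩ : ∃ z, Z = 2*z := ⟨Z/2, by omega⟩
    have : X'^6 % 2 = 1 := by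
      have : X'^6 = (X'^3)^2 := by ring
      rw [this, sq_par]; exact hX3
    ring_nf
    omega
  obtain ⟨r, zo, hzo, hz⟩ := Nat.exists_eq_two_pow_mul_odd x.den_ne_zero
  have hzo' : (zo:ℤ) % 2 = 1 := by
    obtain ⟨t, rfl⟩ := hzo
    omega
  have hz' : Z = 2^r * (zo:ℤ) := by rw [hZ, hz]; push_cast; rfl
  have hD : Data X' (-Z) 0 := by
    rcases (by omega : (Y - X'^3) % 4 = 0 ∨ (-Y - X'^3) % 4 = 0) with h4 | h4
    · exact point_data X' Z Y r zo hz' hzo' hZ2 hX2 hcop h4 hYZ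
    · exact point_data X' Z (-Y) r zo hz' hzo' hZ2 hX2 hcop h4 (by rw [← hYZ]; ring)
  have := D.zero hD hX2 (by omega) (by omega)
  omega
end C9

/-- The genus 2 curve `y² = x⁶ - 2x⁵ + 5x⁴ - 6x³ + 10x² - 8x + 5`
has no affine rational points. -/
theorem stmt_9 :
    ¬ ∃ x y : ℚ,
      y ^ 2 = x ^ 6 - 2 * x ^ 5 + 5 * x ^ 4 - 6 * x ^ 3 + 10 * x ^ 2 -
        8 * x + 5 := by
  rintro ⟨x, y, h⟩
  obtain ⟨K, _, _, ⟨D⟩⟩ := C9.exists_FD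
  exact D.no_point x y h
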